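/- arXiv:1211.0734 — 2 statements merged into one kernel-verified Lean document; each statement's English description precedes it below -/
import Mathlib

section
/- If A is a complete intersection noetherian local ring, then there exists a test module for A of finite upper complete intersection dimension; in particular, the residue field k is such a module. -/
open CategoryTheory IsLocalRing

universe u

/-! ## Homological dimensions -/

/-- Flat dimension at most `n`: `M` is flat, or there is a surjection from a flat
module whose kernel has flat dimension at most `n - 1`. -/
def FlatDimLE (A : Type u) [CommRing A] :
    ℕ → ∀ (M : Type u) [AddCommGroup M] [Module A M], Prop
  | 0 => fun M _ _ => Module.Flat A M
  | n + 1 => fun M _ _ =>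
      ∃ (F : Type u) (_ : AddCommGroup F) (_ : Module A F), Module.Flat A F ∧
        ∃ f : F →ₗ[A] M, Function.Surjective f ∧ FlatDimLE A n (LinearMap.ker f)

/-- Projective dimension at most `n`. -/
def ProjDimLE (A : Type u) [CommRing A] :
    ℕ → ∀ (M : Type u) [AddCommGroup M] [Module A M], Prop
  | 0 => fun M _ _ => Module.Projective A M
  | n + 1 => fun M _ _ =>
      ∃ (P : Type u) (_ : AddCommGroup P) (_ : Module A P), Module.Projective A P ∧
        ∃ f : P →ₗ[A] M, Function.Surjective f ∧ ProjDimLE A n (LinearMap.ker f)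

/-- Injective dimension at most `n`. -/
def InjDimLE (A : Type u) [CommRing A] :
    ℕ → ∀ (M : Type u) [AddCommGroup M] [Module A M], Prop
  | 0 => fun M _ _ => Module.Injective A M
  | n + 1 => fun M _ _ =>
      ∃ (I : Type u) (_ : AddCommGroup I) (_ : Module A I), Module.Injective A I ∧
        ∃ f : M →ₗ[A] I, Function.Injective f ∧ InjDimLE A n (I ⧸ LinearMap.range f)

/-! ## Classes of local rings -/

/-- A Gorenstein (noetherian) local ring: a noetherian local ring having finite injective
dimension as a module over itself. -/
def IsGorensteinLocalRing (A : Type u) [CommRing A] : Prop :=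
  IsNoetherianRing A ∧ IsLocalRing A ∧ ∃ n : ℕ, InjDimLE A n A

/-- A regular local ring: a noetherian local ring whose maximal ideal is generated by
`dim A` elements. -/
def IsRegularLocal (A : Type u) [CommRing A] : Prop :=
  IsNoetherianRing A ∧ IsLocalRing A ∧
    ∃ s : Finset A, (Ideal.span (s : Set A)).IsMaximal ∧
      (s.card : WithBot ℕ∞) = ringKrullDim A

/-- A deformation: a surjective ring homomorphism whose kernel is generated by a
regular sequence. -/
def IsDeformation {Q A' : Type u} [CommRing Q] [CommRing A'] (f : Q →+* A') : Prop :=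
  Function.Surjective f ∧
    ∃ rs : List Q, RingTheory.Sequence.IsRegular Q rs ∧
      RingHom.ker f = Ideal.span {x | x ∈ rs}

/-- A noetherian local ring is complete intersection if its `m`-adic completion is a
quotient of a regular local ring by an ideal generated by a regular sequence. -/
def IsCompleteIntersectionLocalRing (A : Type u) [CommRing A] [IsLocalRing A] : Prop :=
  ∃ (Q : Type u) (_ : CommRing Q), IsRegularLocal Q ∧
    ∃ f : Q →+* AdicCompletion (maximalIdeal A) A, IsDeformation f

/-! ## Tor, test modules -/

/-- Vanishing of `Tor_i^A(M, N)`. -/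
def TorVanish (A : Type u) [CommRing A] (i : ℕ)
    (M : Type u) [AddCommGroup M] [Module A M]
    (N : Type u) [AddCommGroup N] [Module A N] : Prop :=
  Subsingleton (((Tor (ModuleCat.{u} A) i).obj (ModuleCat.of A M)).obj (ModuleCat.of A N))

/-- `M` is a test module for `A`: for every local homomorphism `A → B` of noetherian local
rings and every finitely generated `B`-module `N`, vanishing of `Tor_i^A(M,N)` for all
`i ≫ 0` implies that `N` has finite flat dimension over `A`. -/
def IsTestModule (A : Type u) [CommRing A] [IsLocalRing A] [IsNoetherianRing A]
    (M : Type u) [AddCommGroup M] [Module A M] : Prop :=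
  ∀ (B : Type u) [CommRing B] [IsLocalRing B] [IsNoetherianRing B] [Algebra A B],
    IsLocalHom (algebraMap A B) →
    ∀ (N : Type u) [AddCommGroup N] [Module A N] [Module B N] [IsScalarTower A B N],
      Module.Finite B N →
      (∃ i₀ : ℕ, ∀ i ≥ i₀, TorVanish A i M N) →
      ∃ n : ℕ, FlatDimLE A n N

/-- `M` is a Test module for `A`: for every finitely generated `A`-module `N`, vanishing of
`Tor_i^A(M,N)` for all `i ≫ 0` implies that `N` has finite flat dimension over `A`. -/
def IsCapitalTestModule (A : Type u) [CommRing A] [IsLocalRing A] [IsNoetherianRing A]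
    (M : Type u) [AddCommGroup M] [Module A M] : Prop :=
  ∀ (N : Type u) [AddCommGroup N] [Module A N], Module.Finite A N →
    (∃ i₀ : ℕ, ∀ i ≥ i₀, TorVanish A i M N) →
    ∃ n : ℕ, FlatDimLE A n N

/-! ## Weakly regular homomorphisms and upper CI dimension -/

/-- `A → A'` (given as an algebra) is a weakly regular local homomorphism: it is a local
homomorphism, flat, and the closed fiber `A' ⊗_A k = A'/m A'` is a regular local ring. -/
def IsWeaklyRegularAlgebra (A : Type u) [CommRing A] [IsLocalRing A]
    (A' : Type u) [CommRing A'] [Algebra A A'] : Prop :=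
  IsLocalHom (algebraMap A A') ∧ Module.Flat A A' ∧
    IsRegularLocal (A' ⧸ Ideal.map (algebraMap A A') (maximalIdeal A))

/-- `M` has finite upper complete intersection dimension `CI*-dim_A(M) < ∞`: there are a
weakly regular homomorphism `A → A'` of noetherian local rings and a deformation `Q → A'`
such that `pd_Q (A' ⊗_A M) < ∞`. -/
def CIStarDimFinite (A : Type u) [CommRing A] [IsLocalRing A]
    (M : Type u) [AddCommGroup M] [Module A M] : Prop :=
  ∃ (A' : Type u) (_ : CommRing A') (_ : IsLocalRing A') (_ : IsNoetherianRing A')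
    (_ : Algebra A A'), IsWeaklyRegularAlgebra A A' ∧
    ∃ (Q : Type u) (_ : CommRing Q) (_ : IsLocalRing Q) (_ : IsNoetherianRing Q)
      (f : Q →+* A'), IsDeformation f ∧
        ∃ n : ℕ,
          let _inst : Module Q (TensorProduct A A' M) :=
            Module.compHom (TensorProduct A A' M) f
          ProjDimLE Q n (TensorProduct A A' M)

/-! ## Gorenstein dimension -/

/-- Vanishing of `Ext^i_A(M, N)`. -/
def ExtVanish (A : Type u) [CommRing A] (i : ℕ)
    (M : Type u) [AddCommGroup M] [Module A M]
    (N : Type u) [AddCommGroup N] [Module A N] : Prop :=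
  Subsingleton (((Ext A (ModuleCat.{u} A) i).obj (Opposite.op (ModuleCat.of A M))).obj
    (ModuleCat.of A N))

/-- `G-dim_A M = 0`: the biduality map is an isomorphism and
`Ext^i(M, A) = 0 = Ext^i(M*, A)` for `i > 0`. -/
def GDimZero (A : Type u) [CommRing A] (M : Type u) [AddCommGroup M] [Module A M] : Prop :=
  Function.Bijective (Module.Dual.eval A M) ∧
    (∀ i > 0, ExtVanish A i M A) ∧
    (∀ i > 0, ExtVanish A i (Module.Dual A M) A)

/-- `G-dim_A M ≤ n`: `M` admits a resolution of length `n` by modules of G-dimension `0`. -/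
def GDimLE (A : Type u) [CommRing A] :
    ℕ → ∀ (M : Type u) [AddCommGroup M] [Module A M], Prop
  | 0 => fun M _ _ => GDimZero A M
  | n + 1 => fun M _ _ =>
      ∃ (T : Type u) (_ : AddCommGroup T) (_ : Module A T), GDimZero A T ∧
        ∃ f : T →ₗ[A] M, Function.Surjective f ∧ GDimLE A n (LinearMap.ker f)

/-! ## Complexity -/

/-- The length of a module: the length of the longest chain in its lattice of submodules.
For a module annihilated by the maximal ideal (such as `Tor_n^A(M, k)`) this is its
dimension as a `k`-vector space. -/
noncomputable def moduleLength (A : Type u) [CommRing A]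
    (M : Type u) [AddCommGroup M] [Module A M] : WithBot ℕ∞ :=
  Order.krullDim (Submodule A M)

/-- `cx_A(M) ≤ c`: there exists a real `α` with
`dim_k Tor_n^A(M, k) ≤ α n^(c-1)` for all `n ≫ 0`. -/
def ComplexityLE (A : Type u) [CommRing A] [IsLocalRing A]
    (M : Type u) [AddCommGroup M] [Module A M] (c : ℕ) : Prop :=
  ∃ α : ℝ, ∃ n₀ : ℕ, ∀ n ≥ n₀, ∃ d : ℕ,
    moduleLength A
      (((Tor (ModuleCat.{u} A) n).obj (ModuleCat.of A M)).obj
        (ModuleCat.of A (ResidueField A))) = (d : ℕ∞) ∧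
      (d : ℝ) ≤ α * (n : ℝ) ^ ((c : ℤ) - 1)

/-- The complexity `cx_A(M)`: the least `c` as above. -/
noncomputable def complexity (A : Type u) [CommRing A] [IsLocalRing A]
    (M : Type u) [AddCommGroup M] [Module A M] : ℕ :=
  sInf {c : ℕ | ComplexityLE A M c}

/-- The embedding dimension `dim_k m/m²` of a local ring. -/
noncomputable def embDim (A : Type u) [CommRing A] [IsLocalRing A] : ℕ :=
  Module.finrank (ResidueField A) (CotangentSpace A)


/-! ## Regular local rings -/

theorem regAux_exists_avoid (R : Type u) [CommRing R] [IsLocalRing R] [IsNoetherianRing R]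
    (hdim : (1 : WithBot ℕ∞) ≤ ringKrullDim R) :
    ∃ x ∈ maximalIdeal R, x ∉ (maximalIdeal R) ^ 2 ∧ ∀ p ∈ minimalPrimes R, x ∉ p := by
  classical
  by_contra hcon
  push Not at hcon
  have hfin := minimalPrimes.finite_of_isNoetherianRing R
  have hmin : maximalIdeal R ∉ minimalPrimes R := by
    intro h
    rw [← Ideal.height_eq_zero_iff] at h
    rw [← maximalIdeal_height_eq_ringKrullDim, h] at hdim
    norm_num at hdim
  have hsub : ((maximalIdeal R : Ideal R) : Set R) ⊆
      ⋃ i ∈ (insert ((maximalIdeal R) ^ 2) (minimalPrimes R)), ((id i : Ideal R) : Set R) := by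
    intro x hx
    simp only [Set.mem_iUnion]
    by_cases h2 : x ∈ (maximalIdeal R) ^ 2
    · exact ⟨_, Set.mem_insert _ _, h2⟩
    · obtain ⟨p, hp, hxp⟩ := hcon x hx h2
      exact ⟨p, Set.mem_insert_of_mem _ hp, hxp⟩
  rw [Ideal.subset_union_prime_finite (hfin.insert _) ((maximalIdeal R) ^ 2)
    ((maximalIdeal R) ^ 2)] at hsub
  · obtain ⟨i, hi, hle⟩ := hsub
    rcases hi with rfl | hi
    · have hbot : maximalIdeal R = ⊥ := by
        refine Submodule.eq_bot_of_le_smul_of_le_jacobson_bot (maximalIdeal R) _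
          (IsNoetherian.noetherian _) ?_ (IsLocalRing.maximalIdeal_le_jacobson _)
        simpa [pow_two] using hle
      apply hmin
      obtain ⟨p, hp, hle⟩ := Ideal.exists_minimalPrimes_le (bot_le : (⊥ : Ideal R) ≤ maximalIdeal R)
      have : p = maximalIdeal R := by
        apply le_antisymm hle
        rw [hbot]; exact bot_le
      rw [← this]; exact hp
    · apply hmin
      have hp : i.IsPrime := hi.1.1
      have : i = maximalIdeal R := le_antisymm (IsLocalRing.le_maximalIdeal hp.ne_top) hle
      rwa [← this]
  · intro i hi h1 _
    rcases hi with rfl | hi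
    · exact absurd rfl h1
    · exact hi.1.1

theorem regAux (d : ℕ) : ∀ (R : Type u) [CommRing R] [IsLocalRing R] [IsNoetherianRing R]
    (g : Fin d → R), Ideal.span (Set.range g) = maximalIdeal R →
    (d : WithBot ℕ∞) ≤ ringKrullDim R →
    IsDomain R ∧ ∃ rs : List R, RingTheory.Sequence.IsWeaklyRegular R rs ∧
      Ideal.ofList rs = maximalIdeal R := by
  induction d with
  | zero =>
    intro R _ _ _ g hg hd
    have hbot : maximalIdeal R = ⊥ := by
      rw [← hg, Set.range_eq_empty, Ideal.span_empty]
    refine ⟨?_, [], by simp, by simp [hbot]⟩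
    exact (IsLocalRing.isField_iff_maximalIdeal_eq.mpr hbot).isDomain
  | succ d ih =>
    intro R _ _ _ g hg hd
    obtain ⟨x, hxm, hx2, hxp⟩ := regAux_exists_avoid R (le_trans (by
      norm_cast; simp) hd)
    have hgm : ∀ i, g i ∈ maximalIdeal R := fun i => by
      rw [← hg]; exact Ideal.subset_span ⟨i, rfl⟩
    -- write x in terms of generators
    obtain ⟨c, hc⟩ : ∃ c : Fin (d + 1) → R, ∑ i, c i * g i = x := by
      have : x ∈ Ideal.span (Set.range g) := by rwa [hg]
      exact (Ideal.mem_span_range_iff_exists_fun).mp this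
    obtain ⟨j, hj⟩ : ∃ j, IsUnit (c j) := by
      by_contra hcon
      push Not at hcon
      apply hx2
      rw [← hc, pow_two]
      exact Ideal.sum_mem _ fun i _ => Ideal.mul_mem_mul
        ((IsLocalRing.mem_maximalIdeal _).mpr (hcon i)) (hgm i)
    let S := R ⧸ Ideal.span {x}
    have hne : Ideal.span {x} ≠ ⊤ := by
      rw [Ne, Ideal.span_singleton_eq_top]; exact hxm
    have : Nontrivial S := Ideal.Quotient.nontrivial_iff.mpr hne
    have hloc : IsLocalRing S := IsLocalRing.of_surjective' (Ideal.Quotient.mk (Ideal.span {x}))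
      Ideal.Quotient.mk_surjective
    have hmap : Ideal.map (Ideal.Quotient.mk (Ideal.span {x})) (maximalIdeal R) =
        maximalIdeal S := by
      have h1 := Ideal.map_eq_top_or_isMaximal_of_surjective (Ideal.Quotient.mk (Ideal.span {x}))
        Ideal.Quotient.mk_surjective (IsLocalRing.maximalIdeal.isMaximal R)
      rcases h1 with h1 | h1
      · exfalso
        have h3 := congrArg (Ideal.comap (Ideal.Quotient.mk (Ideal.span {x}))) h1
        rw [Ideal.comap_map_of_surjective _ Ideal.Quotient.mk_surjective, Ideal.comap_top,
          ← RingHom.ker_eq_comap_bot, Ideal.mk_ker] at h3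
        have : Ideal.span {x} ≤ maximalIdeal R := by
          rw [Ideal.span_le]; simpa using hxm
        rw [sup_eq_left.mpr this] at h3
        exact (IsLocalRing.maximalIdeal.isMaximal R).ne_top h3
      · exact IsLocalRing.eq_maximalIdeal h1
    have key := ih S (fun i => Ideal.Quotient.mk _ (g (j.succAbove i))) ?_ ?_
    · obtain ⟨hdom, rs, hrs, hrsm⟩ := key
      have hprime : (Ideal.span {x}).IsPrime := (Ideal.Quotient.isDomain_iff_prime _).mp hdom
      obtain ⟨p, hp, hple⟩ := Ideal.exists_minimalPrimes_le
        (bot_le : (⊥ : Ideal R) ≤ Ideal.span {x})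
      have hpp : p.IsPrime := hp.1.1
      have hxnp : x ∉ p := hxp p hp
      have hpbot : p = ⊥ := by
        refine Submodule.eq_bot_of_le_smul_of_le_jacobson_bot (maximalIdeal R) _
          (IsNoetherian.noetherian _) ?_ (IsLocalRing.maximalIdeal_le_jacobson _)
        intro y hy
        obtain ⟨a, rfl⟩ := Ideal.mem_span_singleton'.mp (hple hy)
        have ha : a ∈ p := (hpp.mem_or_mem hy).resolve_right hxnp
        rw [mul_comm]
        exact Submodule.smul_mem_smul hxm ha
      have hR : IsDomain R := by
        rw [hpbot] at hpp
        exact IsDomain.of_bot_isPrime R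
      refine ⟨hR, ?_⟩
      have hx0 : x ≠ 0 := by
        rintro rfl; exact hxnp p.zero_mem
      obtain ⟨rs', rfl⟩ : ∃ rs' : List R, rs'.map (Ideal.Quotient.mk (Ideal.span {x})) = rs :=
        List.map_surjective_iff.mpr Ideal.Quotient.mk_surjective rs
      refine ⟨x :: rs', ?_, ?_⟩
      · rw [RingTheory.Sequence.isWeaklyRegular_cons_iff]
        refine ⟨fun a b hab => mul_left_cancel₀ hx0 hab, ?_⟩
        have h1 := (RingTheory.Sequence.isWeaklyRegular_map_algebraMap_iff S S rs').mp hrs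
        have e : S ≃ₗ[R] QuotSMulTop x R := Submodule.quotEquivOfEq _ _ (by
          simp [← Submodule.ideal_span_singleton_smul])
        exact (e.isWeaklyRegular_congr rs').mp h1
      · rw [Ideal.ofList_cons]
        have h2 := congrArg (Ideal.comap (Ideal.Quotient.mk (Ideal.span {x}))) hrsm
        rw [← hmap, ← Ideal.map_ofList,
          Ideal.comap_map_of_surjective _ Ideal.Quotient.mk_surjective,
          Ideal.comap_map_of_surjective _ Ideal.Quotient.mk_surjective,
          ← RingHom.ker_eq_comap_bot, Ideal.mk_ker, sup_comm] at h2
        rw [h2, sup_eq_left, Ideal.span_le]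
        simpa using hxm
    · rw [← hmap, ← hg, Ideal.map_span]
      apply le_antisymm
      · rw [Ideal.span_le]
        rintro _ ⟨i, rfl⟩
        exact Ideal.subset_span ⟨_, ⟨_, rfl⟩, rfl⟩
      · rw [Ideal.span_le]
        rintro _ ⟨_, ⟨i, rfl⟩, rfl⟩
        rcases Fin.eq_self_or_eq_succAbove j i with rfl | ⟨i', rfl⟩
        · have h0 : Ideal.Quotient.mk (Ideal.span {x}) x = 0 :=
            Ideal.Quotient.eq_zero_iff_mem.mpr (Ideal.mem_span_singleton_self x)
          have h1 := congrArg (Ideal.Quotient.mk (Ideal.span {x})) hc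
          rw [h0, Fin.sum_univ_succAbove _ i, map_add, map_mul, map_sum] at h1
          have hu : IsUnit (Ideal.Quotient.mk (Ideal.span {x}) (c i)) := hj.map _
          refine (Ideal.unit_mul_mem_iff_mem _ hu).mp ?_
          rw [eq_neg_of_add_eq_zero_left h1]
          refine (Submodule.neg_mem_iff _).mpr (Ideal.sum_mem _ fun k _ => ?_)
          rw [map_mul]
          exact Ideal.mul_mem_left _ _ (Ideal.subset_span ⟨k, rfl⟩)
        · exact Ideal.subset_span ⟨i', rfl⟩
    · have h1 := ringKrullDim_le_ringKrullDim_quotient_add_card ({x} : Finset R) (by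
        simpa [IsLocalRing.ringJacobson_eq_maximalIdeal] using hxm)
      rw [Finset.coe_singleton, Finset.card_singleton] at h1
      have h2 : ((d : WithBot ℕ∞) + 1) ≤ ringKrullDim S + 1 := by
        refine le_trans ?_ (le_trans hd h1)
        push_cast; exact le_rfl
      exact (ENat.WithBot.add_le_add_one_right_iff).mp h2

theorem projDimLE_of_hasProjectiveDimensionLE (R : Type u) [CommRing R] (n : ℕ) :
    ∀ (M : Type u) [AddCommGroup M] [Module R M],
      HasProjectiveDimensionLT (ModuleCat.of R M) (n + 1) → ProjDimLE R n M := by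
  induction n with
  | zero =>
    intro M _ _ h
    have : Projective (ModuleCat.of R M) := projective_iff_hasProjectiveDimensionLT_one.mpr h
    exact (IsProjective.iff_projective M).mpr this
  | succ n ih =>
    intro M _ _ h
    refine ⟨M →₀ R, inferInstance, inferInstance, inferInstance,
      Finsupp.linearCombination R id, Finsupp.linearCombination_id_surjective R M, ?_⟩
    apply ih
    have hS := LinearMap.shortExact_shortComplexKer
      (Finsupp.linearCombination_id_surjective R M)
    have hp : Projective (ModuleCat.of R (M →₀ R)) :=
      (IsProjective.iff_projective _).mp inferInstance
    exact (hS.hasProjectiveDimensionLT_X₃_iff n hp).mp h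

theorem exists_pd_residue (Q : Type u) [CommRing Q] [IsLocalRing Q] [IsNoetherianRing Q]
    (hQ : IsRegularLocal Q) :
    ∃ n : ℕ, HasProjectiveDimensionLT (ModuleCat.of Q (Q ⧸ maximalIdeal Q)) (n + 1) := by
  obtain ⟨_, _, s, hs, hcard⟩ := hQ
  have hsm : Ideal.span (s : Set Q) = maximalIdeal Q := IsLocalRing.eq_maximalIdeal hs
  obtain ⟨_, rs, hrs, hrm⟩ := regAux s.card Q (fun i => (s.equivFin.symm i : Q)) (by
    rw [← hsm]
    congr 1
    ext y
    constructor
    · rintro ⟨i, rfl⟩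
      exact (s.equivFin.symm i).2
    · intro hy
      exact ⟨s.equivFin ⟨y, hy⟩, by simp⟩) hcard.le
  have hreg : RingTheory.Sequence.IsRegular Q rs := by
    refine ⟨hrs, ?_⟩
    rw [hrm]
    simpa using (IsLocalRing.maximalIdeal.isMaximal Q).ne_top.symm
  have h := ModuleCat.projectiveDimension_quotient_eq_length.{u} rs hreg
  rw [projectiveDimension_eq_of_iso (Shrink.linearEquiv.{u} Q (Q ⧸ Ideal.ofList rs)).toModuleIso,
    hrm] at h
  exact ⟨rs.length, (projectiveDimension_le_iff _ _).mp h.le⟩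


/-! ## Finite upper complete intersection dimension of the residue field -/

theorem isRegularLocal_quotient_maximal (R : Type u) [CommRing R] (I : Ideal R)
    (hI : I.IsMaximal) : IsRegularLocal (R ⧸ I) := by
  letI : Field (R ⧸ I) := Ideal.Quotient.field I
  refine ⟨inferInstance, inferInstance, ∅, ?_, ?_⟩
  · rw [Finset.coe_empty, Ideal.span_empty]
    exact Ideal.bot_isMaximal
  · rw [ringKrullDim_eq_zero_of_field]; simp

theorem ciStar_residueField (A : Type u) [CommRing A] [IsLocalRing A] [IsNoetherianRing A]
    (hA : IsCompleteIntersectionLocalRing A) : CIStarDimFinite A (ResidueField A) := by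
  obtain ⟨Q, hQc, hQ, f, hf⟩ := hA
  have hQn : IsNoetherianRing Q := hQ.1
  have hQl : IsLocalRing Q := hQ.2.1
  have hn : IsNoetherianRing (AdicCompletion (maximalIdeal A) A) :=
    isNoetherianRing_of_surjective _ _ f hf.1
  refine ⟨AdicCompletion (maximalIdeal A) A, inferInstance, inferInstance, hn, inferInstance,
    ⟨inferInstance, inferInstance, ?_⟩, Q, hQc, hQl, hQn, f, hf, ?_⟩
  · rw [← AdicCompletion.maximalIdeal_eq_map]
    exact isRegularLocal_quotient_maximal _ _ (IsLocalRing.maximalIdeal.isMaximal _)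
  obtain ⟨n, hn⟩ := exists_pd_residue Q hQ
  refine ⟨n, ?_⟩
  intro _inst
  apply projDimLE_of_hasProjectiveDimensionLE
  let T := TensorProduct A (AdicCompletion (maximalIdeal A) A) (ResidueField A)
  have hsmul : ∀ (q : Q) (t : T), q • t = f q • t := fun _ _ => rfl
  let t₀ : T := TensorProduct.tmul A 1 1
  let φ : Q →ₗ[Q] T := LinearMap.toSpanSingleton Q T t₀
  have hφ : ∀ q, φ q = TensorProduct.tmul A (f q) 1 := by
    intro q
    change q • t₀ = _
    rw [hsmul, TensorProduct.smul_tmul', smul_eq_mul, mul_one]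
  have hsurj : Function.Surjective φ := by
    intro t
    induction t using TensorProduct.induction_on with
    | zero => exact ⟨0, map_zero _⟩
    | add a b ha hb =>
      obtain ⟨a', rfl⟩ := ha
      obtain ⟨b', rfl⟩ := hb
      exact ⟨a' + b', map_add _ _ _⟩
    | tmul a c =>
      obtain ⟨r, rfl⟩ := IsLocalRing.residue_surjective c
      obtain ⟨q, hq⟩ := hf.1 (r • a)
      refine ⟨q, ?_⟩
      rw [hφ, hq, TensorProduct.smul_tmul]
      congr 1
      rw [Algebra.smul_def, mul_one]; rfl
  have hnt : t₀ ≠ 0 := by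
    let ψ : T →ₐ[A] ResidueField A := Algebra.TensorProduct.lift
      (AdicCompletion.evalOneₐ (maximalIdeal A) : _ →ₐ[A] A ⧸ maximalIdeal A)
      (AlgHom.id A (ResidueField A)) (fun _ _ => Commute.all _ _)
    intro h
    have h1 : ψ 1 = 0 := by
      have : (1 : T) = t₀ := rfl
      rw [this, h, map_zero]
    rw [map_one] at h1
    exact one_ne_zero h1
  have hker : LinearMap.ker φ = maximalIdeal Q := by
    symm
    refine (IsLocalRing.maximalIdeal.isMaximal Q).eq_of_le ?_ ?_
    · rw [Ne, Ideal.eq_top_iff_one, LinearMap.mem_ker]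
      intro h
      apply hnt
      rw [hφ, map_one] at h
      exact h
    · intro q hq
      rw [LinearMap.mem_ker, hφ]
      have hloc : IsLocalHom f := IsLocalHom.of_surjective f hf.1
      have h1 : f q ∈ maximalIdeal (AdicCompletion (maximalIdeal A) A) := by
        rw [IsLocalRing.mem_maximalIdeal] at hq ⊢
        exact (map_mem_nonunits_iff f q).mpr hq
      rw [AdicCompletion.maximalIdeal_eq_map] at h1
      generalize f q = y at h1
      refine Submodule.span_induction (p := fun y _ => (TensorProduct.tmul A y 1 : T) = 0)
        ?_ ?_ ?_ ?_ h1
      · rintro _ ⟨r, hr, rfl⟩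
        rw [Algebra.algebraMap_eq_smul_one, TensorProduct.smul_tmul, Algebra.smul_def, mul_one]
        have : algebraMap A (ResidueField A) r = 0 := (IsLocalRing.residue_eq_zero_iff r).mpr hr
        rw [this, TensorProduct.tmul_zero]
      · exact TensorProduct.zero_tmul _ _
      · intro a b _ _ ha hb
        rw [TensorProduct.add_tmul, ha, hb, add_zero]
      · intro a b _ hb
        rw [← TensorProduct.smul_tmul', hb, smul_zero]
  let e : (Q ⧸ maximalIdeal Q) ≃ₗ[Q] T :=
    (Submodule.quotEquivOfEq _ _ hker.symm).trans (φ.quotKerEquivOfSurjective hsurj)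
  exact hasProjectiveDimensionLT_of_iso e.toModuleIso (n + 1)


/-! ## The residue field is a test module -/

section TorPart

open TensorProduct

theorem FlatDimLE.congr (A : Type u) [CommRing A] (n : ℕ) :
    ∀ (M M' : Type u) [AddCommGroup M] [Module A M] [AddCommGroup M'] [Module A M'],
      (M ≃ₗ[A] M') → FlatDimLE A n M → FlatDimLE A n M' := by
  induction n with
  | zero =>
    intro M M' _ _ _ _ e h
    have : Module.Flat A M := h
    exact Module.Flat.of_linearEquiv e.symm
  | succ n ih =>
    rintro M M' _ _ _ _ e ⟨F, _, _, hF, f, hf, hk⟩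
    refine ⟨F, inferInstance, inferInstance, hF, e.toLinearMap.comp f,
      e.surjective.comp hf, ?_⟩
    refine ih _ _ (LinearEquiv.ofEq _ _ ?_) hk
    ext x; simp

/-- A small snake lemma. -/
theorem snakeEquiv {A : Type u} [CommRing A]
    {X₁ X₂ X₃ Y₁ Y₂ Y₃ Z₁ Z₂ : Type u}
    [AddCommGroup X₁] [AddCommGroup X₂] [AddCommGroup X₃]
    [AddCommGroup Y₁] [AddCommGroup Y₂] [AddCommGroup Y₃]
    [AddCommGroup Z₁] [AddCommGroup Z₂]
    [Module A X₁] [Module A X₂] [Module A X₃] [Module A Y₁] [Module A Y₂] [Module A Y₃]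
    [Module A Z₁] [Module A Z₂]
    (p₁ : X₁ →ₗ[A] X₂) (p₂ : X₂ →ₗ[A] X₃) (q₁ : Y₁ →ₗ[A] Y₂) (q₂ : Y₂ →ₗ[A] Y₃)
    (r₁ : Z₁ →ₗ[A] Z₂)
    (v₁ : X₁ →ₗ[A] Y₁) (v₂ : X₂ →ₗ[A] Y₂) (v₃ : X₃ →ₗ[A] Y₃)
    (w₁ : Y₁ →ₗ[A] Z₁) (w₂ : Y₂ →ₗ[A] Z₂)
    (hp : Function.Exact p₁ p₂) (hp₂ : Function.Surjective p₂)
    (hq : Function.Exact q₁ q₂) (hq₁ : Function.Injective q₁)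
    (hv₁ : Function.Exact v₁ w₁) (hw₁ : Function.Surjective w₁)
    (hv₂ : Function.Exact v₂ w₂) (hv₂i : Function.Injective v₂)
    (c₁ : ∀ x, q₁ (v₁ x) = v₂ (p₁ x)) (c₂ : ∀ x, q₂ (v₂ x) = v₃ (p₂ x))
    (c₃ : ∀ y, r₁ (w₁ y) = w₂ (q₁ y)) :
    Nonempty (LinearMap.ker v₃ ≃ₗ[A] LinearMap.ker r₁) := by
  let W : Submodule A (X₂ × Y₁) :=
    LinearMap.eqLocus (v₂.comp (LinearMap.fst A X₂ Y₁)) (q₁.comp (LinearMap.snd A X₂ Y₁))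
  have hW : ∀ z : X₂ × Y₁, z ∈ W ↔ v₂ z.1 = q₁ z.2 := fun z => Iff.rfl
  let φ : W →ₗ[A] X₃ := (p₂.comp (LinearMap.fst A X₂ Y₁)).comp W.subtype
  let ψ : W →ₗ[A] Z₁ := (w₁.comp (LinearMap.snd A X₂ Y₁)).comp W.subtype
  have hφ : LinearMap.range φ = LinearMap.ker v₃ := by
    apply le_antisymm
    · rintro _ ⟨⟨⟨a, b⟩, h⟩, rfl⟩
      rw [hW] at h
      change v₃ (p₂ a) = 0
      rw [← c₂]
      rw [show v₂ a = q₁ b from h]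
      exact hq.apply_apply_eq_zero b
    · intro t ht
      obtain ⟨a, rfl⟩ := hp₂ t
      rw [LinearMap.mem_ker, ← c₂] at ht
      obtain ⟨b, hb⟩ := (hq _).mp ht
      exact ⟨⟨(a, b), hb.symm⟩, rfl⟩
  have hψ : LinearMap.range ψ = LinearMap.ker r₁ := by
    apply le_antisymm
    · rintro _ ⟨⟨⟨a, b⟩, h⟩, rfl⟩
      rw [hW] at h
      change r₁ (w₁ b) = 0
      rw [c₃, ← show v₂ a = q₁ b from h]
      exact hv₂.apply_apply_eq_zero a
    · intro t ht
      obtain ⟨b, rfl⟩ := hw₁ t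
      rw [LinearMap.mem_ker, c₃] at ht
      obtain ⟨a, ha⟩ := (hv₂ _).mp ht
      exact ⟨⟨(a, b), ha⟩, rfl⟩
  have hker : LinearMap.ker φ = LinearMap.ker ψ := by
    ext ⟨⟨a, b⟩, h⟩
    have h' : v₂ a = q₁ b := h
    change p₂ a = 0 ↔ w₁ b = 0
    rw [hp a, hv₁ b]
    constructor
    · rintro ⟨c, rfl⟩
      exact ⟨c, hq₁ (by rw [c₁, h'])⟩
    · rintro ⟨c, rfl⟩
      exact ⟨c, hv₂i (by rw [h', c₁])⟩
  exact ⟨(LinearEquiv.ofEq _ _ hφ.symm).trans (φ.quotKerEquivRange.symm.trans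
    ((Submodule.quotEquivOfEq _ _ hker).trans (ψ.quotKerEquivRange.trans
      (LinearEquiv.ofEq _ _ hψ))))⟩

/-- Balancing `Tor₁`. -/
theorem torBalance {A : Type u} [CommRing A]
    {M' G M K F L : Type u}
    [AddCommGroup M'] [AddCommGroup G] [AddCommGroup M]
    [AddCommGroup K] [AddCommGroup F] [AddCommGroup L]
    [Module A M'] [Module A G] [Module A M] [Module A K] [Module A F] [Module A L]
    [Module.Flat A F] [Module.Flat A G]
    (i : M' →ₗ[A] G) (g : G →ₗ[A] M) (ι : K →ₗ[A] F) (π : F →ₗ[A] L)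
    (hi : Function.Injective i) (hig : Function.Exact i g) (hg : Function.Surjective g)
    (hι : Function.Injective ι) (hιπ : Function.Exact ι π) (hπ : Function.Surjective π) :
    Nonempty (LinearMap.ker (LinearMap.lTensor M ι) ≃ₗ[A]
      LinearMap.ker (LinearMap.rTensor L i)) := by
  refine snakeEquiv (LinearMap.rTensor K i) (LinearMap.rTensor K g)
    (LinearMap.rTensor F i) (LinearMap.rTensor F g) (LinearMap.rTensor L i)
    (LinearMap.lTensor M' ι) (LinearMap.lTensor G ι) (LinearMap.lTensor M ι)
    (LinearMap.lTensor M' π) (LinearMap.lTensor G π)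
    (rTensor_exact K hig hg) (LinearMap.rTensor_surjective K hg)
    (rTensor_exact F hig hg) (Module.Flat.rTensor_preserves_injective_linearMap i hi)
    (lTensor_exact M' hιπ hπ) (LinearMap.lTensor_surjective M' hπ)
    (lTensor_exact G hιπ hπ) (Module.Flat.lTensor_preserves_injective_linearMap ι hι)
    ?_ ?_ ?_
  all_goals
    intro x
    simp only [← LinearMap.comp_apply, LinearMap.rTensor_comp_lTensor,
      LinearMap.lTensor_comp_rTensor]

/-- `Tor₂(M, L)` computed in two ways. -/
theorem torShift {A : Type u} [CommRing A]
    {M' G K F : Type u}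
    [AddCommGroup M'] [AddCommGroup G] [AddCommGroup K] [AddCommGroup F]
    [Module A M'] [Module A G] [Module A K] [Module A F]
    [Module.Flat A F] [Module.Flat A G]
    (i : M' →ₗ[A] G) (ι : K →ₗ[A] F)
    (hi : Function.Injective i) (hι : Function.Injective ι) :
    LinearMap.ker (LinearMap.rTensor K i) = LinearMap.ker (LinearMap.lTensor M' ι) := by
  have h1 : LinearMap.ker ((LinearMap.lTensor G ι).comp (LinearMap.rTensor K i)) =
      LinearMap.ker (LinearMap.rTensor K i) :=
    LinearMap.ker_comp_of_ker_eq_bot _ (LinearMap.ker_eq_bot.mpr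
      (Module.Flat.lTensor_preserves_injective_linearMap ι hι))
  have h2 : LinearMap.ker ((LinearMap.rTensor F i).comp (LinearMap.lTensor M' ι)) =
      LinearMap.ker (LinearMap.lTensor M' ι) :=
    LinearMap.ker_comp_of_ker_eq_bot _ (LinearMap.ker_eq_bot.mpr
      (Module.Flat.rTensor_preserves_injective_linearMap i hi))
  rw [← h1, ← h2, LinearMap.lTensor_comp_rTensor, LinearMap.rTensor_comp_lTensor]

/-- The conclusion of Nakayama's lemma for elements of the maximal ideal. -/
def NakProp (A : Type u) [CommRing A] [IsLocalRing A]
    (T : Type u) [AddCommGroup T] [Module A T] : Prop :=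
  ∀ x ∈ maximalIdeal A, (∀ t : T, ∃ s : T, x • s = t) → ∀ t : T, t = 0

theorem NakProp.congr {A : Type u} [CommRing A] [IsLocalRing A]
    {T T' : Type u} [AddCommGroup T] [Module A T] [AddCommGroup T'] [Module A T']
    (e : T ≃ₗ[A] T') (h : NakProp A T') : NakProp A T := by
  intro x hx hs t
  apply e.injective
  rw [map_zero]
  refine h x hx (fun t' => ?_) _
  obtain ⟨s, hs⟩ := hs (e.symm t')
  exact ⟨e s, by rw [← map_smul, hs, e.apply_symm_apply]⟩

theorem NakProp.of_finite {A : Type u} [CommRing A] [IsLocalRing A]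
    (B : Type u) [CommRing B] [IsLocalRing B] [IsNoetherianRing B] [Algebra A B]
    (hloc : IsLocalHom (algebraMap A B))
    {T : Type u} [AddCommGroup T] [Module A T] [Module B T] [IsScalarTower A B T]
    [Module.Finite B T] : NakProp A T := by
  intro x hx hs t
  have hxB : algebraMap A B x ∈ maximalIdeal B := by
    rw [IsLocalRing.mem_maximalIdeal] at hx ⊢
    exact (map_mem_nonunits_iff (algebraMap A B) x).mpr hx
  have : (⊤ : Submodule B T) = ⊥ := by
    refine Submodule.eq_bot_of_le_smul_of_le_jacobson_bot (maximalIdeal B) _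
      Module.Finite.fg_top ?_ (IsLocalRing.maximalIdeal_le_jacobson _)
    intro t _
    obtain ⟨s, rfl⟩ := hs t
    rw [← algebraMap_smul B x s]
    exact Submodule.smul_mem_smul hxB trivial
  have ht : t ∈ (⊤ : Submodule B T) := trivial
  rwa [this] at ht

theorem finite_tensor {A : Type u} [CommRing A]
    (B : Type u) [CommRing B] [Algebra A B]
    (N M : Type u) [AddCommGroup N] [Module A N] [Module B N] [IsScalarTower A B N]
    [AddCommGroup M] [Module A M] [Module.Finite B N] [Module.Finite A M] :
    Module.Finite B (N ⊗[A] M) := by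
  obtain ⟨n, f, hf⟩ := Module.Finite.exists_fin' A M
  let e : N ⊗[A] (Fin n → A) ≃ₗ[B] (Fin n → N) := TensorProduct.piScalarRight A B N (Fin n)
  have h1 : Module.Finite B (N ⊗[A] (Fin n → A)) := Module.Finite.equiv e.symm
  exact Module.Finite.of_surjective
    (TensorProduct.AlgebraTensorModule.map (LinearMap.id : N →ₗ[B] N) f)
    (LinearMap.lTensor_surjective N hf)

theorem nak_base {A : Type u} [CommRing A] [IsLocalRing A]
    (B : Type u) [CommRing B] [IsLocalRing B] [IsNoetherianRing B] [Algebra A B]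
    (hloc : IsLocalHom (algebraMap A B))
    {N L M' G : Type u} [AddCommGroup N] [Module A N] [Module B N] [IsScalarTower A B N]
    [Module.Finite B N] [AddCommGroup L] [Module A L] (e : L ≃ₗ[A] N)
    [AddCommGroup M'] [Module A M'] [Module.Finite A M'] [AddCommGroup G] [Module A G]
    (i : M' →ₗ[A] G) : NakProp A (LinearMap.ker (LinearMap.rTensor L i)) := by
  let f : N ⊗[A] M' →ₗ[B] N ⊗[A] G :=
    TensorProduct.AlgebraTensorModule.map (LinearMap.id : N →ₗ[B] N) i
  have hfin := finite_tensor (A := A) B N M'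
  have hk : NakProp A (LinearMap.ker f) := NakProp.of_finite B hloc
  let E : M' ⊗[A] L ≃ₗ[A] N ⊗[A] M' :=
    (TensorProduct.comm A M' L).trans (TensorProduct.congr e (LinearEquiv.refl A M'))
  let E' : G ⊗[A] L ≃ₗ[A] N ⊗[A] G :=
    (TensorProduct.comm A G L).trans (TensorProduct.congr e (LinearEquiv.refl A G))
  have hc : (f.restrictScalars A).comp E.toLinearMap =
      E'.toLinearMap.comp (LinearMap.rTensor L i) := by
    ext m l
    simp [f, E, E']
  have hc' : ∀ t, f (E t) = E' (LinearMap.rTensor L i t) := fun t => LinearMap.congr_fun hc t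
  let e2 : LinearMap.ker (LinearMap.rTensor L i) ≃ₗ[A] LinearMap.ker (f.restrictScalars A) :=
    E.ofSubmodules _ _ (by
      ext t
      rw [Submodule.mem_map]
      constructor
      · rintro ⟨s, hs, rfl⟩
        rw [LinearMap.mem_ker] at hs ⊢
        change f (E s) = 0
        rw [hc', hs, map_zero]
      · intro ht
        refine ⟨E.symm t, ?_, by simp⟩
        rw [LinearMap.mem_ker]
        apply E'.injective
        rw [← hc', map_zero, E.apply_symm_apply]
        exact ht)
  exact NakProp.congr e2 hk

/-- Middle exactness of `Tor₁(-, L)`. -/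
theorem tor_mid {A : Type u} [CommRing A]
    {M₁ M₂ M₃ K F : Type u}
    [AddCommGroup M₁] [AddCommGroup M₂] [AddCommGroup M₃]
    [AddCommGroup K] [AddCommGroup F]
    [Module A M₁] [Module A M₂] [Module A M₃] [Module A K] [Module A F]
    [Module.Flat A F]
    (i : M₁ →ₗ[A] M₂) (g : M₂ →ₗ[A] M₃) (ι : K →ₗ[A] F)
    (hi : Function.Injective i) (hig : Function.Exact i g) (hg : Function.Surjective g)
    (h₃ : Function.Injective (LinearMap.lTensor M₃ ι))
    (t : M₂ ⊗[A] K) (ht : LinearMap.lTensor M₂ ι t = 0) :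
    ∃ s : M₁ ⊗[A] K, LinearMap.lTensor M₁ ι s = 0 ∧ LinearMap.rTensor K i s = t := by
  have h1 : LinearMap.rTensor K g t = 0 := by
    apply h₃
    rw [map_zero, ← LinearMap.comp_apply, LinearMap.lTensor_comp_rTensor,
      ← LinearMap.rTensor_comp_lTensor, LinearMap.comp_apply, ht, map_zero]
  obtain ⟨s, rfl⟩ := (rTensor_exact K hig hg t).mp h1
  refine ⟨s, ?_, rfl⟩
  apply Module.Flat.rTensor_preserves_injective_linearMap (M := F) i hi
  rw [map_zero, ← LinearMap.comp_apply, LinearMap.rTensor_comp_lTensor,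
      ← LinearMap.lTensor_comp_rTensor, LinearMap.comp_apply, ht]

/-- The local criterion, in the form of vanishing for all cyclic modules. -/
theorem tor_cyclic_vanish {A : Type u} [CommRing A] [IsLocalRing A] [IsNoetherianRing A]
    {K F : Type u} [AddCommGroup K] [AddCommGroup F] [Module A K] [Module A F]
    [Module.Flat A F] (ι : K →ₗ[A] F)
    (hnak : ∀ I : Ideal A, NakProp A (LinearMap.ker (LinearMap.lTensor (A ⧸ I) ι)))
    (hk : Function.Injective (LinearMap.lTensor (A ⧸ maximalIdeal A) ι)) :
    ∀ I : Ideal A, Function.Injective (LinearMap.lTensor (A ⧸ I) ι) := by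
  intro I
  induction I using IsNoetherian.induction with
  | hgt I ih =>
  by_cases htop : I = ⊤
  · subst htop
    have : Subsingleton (A ⧸ (⊤ : Ideal A)) := Submodule.Quotient.subsingleton_iff.mpr rfl
    exact Function.injective_of_subsingleton _
  by_cases hm : I = maximalIdeal A
  · subst hm; exact hk
  have hlt : I < maximalIdeal A := lt_of_le_of_ne (IsLocalRing.le_maximalIdeal htop) hm
  obtain ⟨x, hxm, hxI⟩ := SetLike.exists_of_lt hlt
  let J : Ideal A := I ⊔ Ideal.span {x}
  have hIJ : I ≤ J := le_sup_left
  have hxJ : x ∈ J := Ideal.mem_sup_right (Ideal.mem_span_singleton_self x)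
  have hJ : I < J := lt_of_le_of_ne hIJ (fun h => hxI (h ▸ hxJ))
  have h₃ := ih J hJ
  let C : Ideal A := Submodule.comap (LinearMap.mulLeft A x) I
  have hC : ∀ a, a ∈ C ↔ x * a ∈ I := fun a => Iff.rfl
  have hIC : I ≤ C := fun a ha => Ideal.mul_mem_left I x ha
  let i : (A ⧸ C) →ₗ[A] (A ⧸ I) := Submodule.mapQ C I (LinearMap.mulLeft A x) le_rfl
  let g : (A ⧸ I) →ₗ[A] (A ⧸ J) := Submodule.factor hIJ
  have hi : Function.Injective i := by
    rw [← LinearMap.ker_eq_bot, LinearMap.ker_eq_bot']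
    intro a ha
    obtain ⟨a, rfl⟩ := Submodule.mkQ_surjective _ a
    have : x * a ∈ I := (Submodule.Quotient.mk_eq_zero I).mp ha
    exact (Submodule.Quotient.mk_eq_zero C).mpr this
  have hg : Function.Surjective g := Submodule.factor_surjective hIJ
  have hig : Function.Exact i g := by
    intro b
    obtain ⟨b, rfl⟩ := Submodule.mkQ_surjective _ b
    constructor
    · intro hb
      have hb' : b ∈ J := (Submodule.Quotient.mk_eq_zero J).mp hb
      obtain ⟨y, hy, z, hz, rfl⟩ := Submodule.mem_sup.mp hb'
      obtain ⟨a, rfl⟩ := Ideal.mem_span_singleton'.mp hz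
      refine ⟨C.mkQ a, ?_⟩
      change Submodule.Quotient.mk (x * a) = Submodule.Quotient.mk (y + a * x)
      rw [Submodule.Quotient.eq]
      have : x * a - (y + a * x) = - y := by ring
      rw [this]
      exact I.neg_mem hy
    · rintro ⟨a, ha⟩
      obtain ⟨a, rfl⟩ := Submodule.mkQ_surjective _ a
      rw [← ha]
      change Submodule.Quotient.mk (x * a) = (0 : A ⧸ J)
      rw [Submodule.Quotient.mk_eq_zero]
      exact J.mul_mem_right a hxJ
  have hmid := tor_mid i g ι hi hig hg h₃
  rw [← LinearMap.ker_eq_bot, LinearMap.ker_eq_bot']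
  by_cases hCI : C = I
  · have hres := hnak I x hxm (by
      rintro ⟨t, ht⟩
      obtain ⟨s, hs, hst⟩ := hmid t ht
      let ε : (A ⧸ C) →ₗ[A] (A ⧸ I) := (Submodule.quotEquivOfEq C I hCI).toLinearMap
      refine ⟨⟨LinearMap.rTensor K ε s, ?_⟩, ?_⟩
      · rw [LinearMap.mem_ker, ← LinearMap.comp_apply, LinearMap.lTensor_comp_rTensor,
          ← LinearMap.rTensor_comp_lTensor, LinearMap.comp_apply, hs, map_zero]
      · apply Subtype.ext
        change x • LinearMap.rTensor K ε s = t
        rw [← hst, ← LinearMap.smul_apply, ← LinearMap.rTensor_smul]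
        congr 2
        ext
        rfl)
    intro t ht
    exact congrArg Subtype.val (hres ⟨t, ht⟩)
  · have h₁ := ih C (lt_of_le_of_ne hIC (Ne.symm hCI))
    intro t ht
    obtain ⟨s, hs, hst⟩ := hmid t ht
    have : s = 0 := h₁ (by rw [hs, map_zero])
    rw [← hst, this, map_zero]

theorem nak_step {A : Type u} [CommRing A] [IsLocalRing A]
    {M' G M K F L F' : Type u}
    [AddCommGroup M'] [AddCommGroup G] [AddCommGroup M]
    [AddCommGroup K] [AddCommGroup F] [AddCommGroup L] [AddCommGroup F']
    [Module A M'] [Module A G] [Module A M] [Module A K] [Module A F] [Module A L]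
    [Module A F'] [Module.Flat A F] [Module.Flat A G] [Module.Flat A F']
    (i : M' →ₗ[A] G) (g : G →ₗ[A] M) (ι : K →ₗ[A] F) (π : F →ₗ[A] L) (ι' : L →ₗ[A] F')
    (hi : Function.Injective i) (hig : Function.Exact i g) (hg : Function.Surjective g)
    (hι : Function.Injective ι) (hιπ : Function.Exact ι π) (hπ : Function.Surjective π)
    (hι' : Function.Injective ι')
    (h : NakProp A (LinearMap.ker (LinearMap.lTensor M' ι'))) :
    NakProp A (LinearMap.ker (LinearMap.lTensor M ι)) := by
  obtain ⟨E⟩ := torBalance i g ι π hi hig hg hι hιπ hπ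
  exact NakProp.congr (E.trans (LinearEquiv.ofEq _ _ (torShift i ι' hi hι'))) h

/-- An abstract flat resolution, cut into short exact sequences. -/
theorem nak_tor {A : Type u} [CommRing A] [IsLocalRing A] [IsNoetherianRing A]
    (B : Type u) [CommRing B] [IsLocalRing B] [IsNoetherianRing B] [Algebra A B]
    (hloc : IsLocalHom (algebraMap A B))
    {N : Type u} [AddCommGroup N] [Module A N] [Module B N] [IsScalarTower A B N]
    [Module.Finite B N]
    (K F : ℕ → Type u) [∀ n, AddCommGroup (K n)] [∀ n, AddCommGroup (F n)]
    [∀ n, Module A (K n)] [∀ n, Module A (F n)] [∀ n, Module.Flat A (F n)]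
    (ι : ∀ n, K (n + 1) →ₗ[A] F n) (π : ∀ n, F n →ₗ[A] K n)
    (hι : ∀ n, Function.Injective (ι n)) (hιπ : ∀ n, Function.Exact (ι n) (π n))
    (hπ : ∀ n, Function.Surjective (π n)) (e : K 0 ≃ₗ[A] N) (n : ℕ) :
    ∀ (M : Type u) [AddCommGroup M] [Module A M] [Module.Finite A M],
      NakProp A (LinearMap.ker (LinearMap.lTensor M (ι n))) := by
  induction n with
  | zero =>
    intro M _ _ _
    obtain ⟨m, g, hg⟩ := Module.Finite.exists_fin' A M
    obtain ⟨E⟩ := torBalance (LinearMap.ker g).subtype g (ι 0) (π 0)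
      (LinearMap.ker g).injective_subtype (LinearMap.exact_subtype_ker_map g) hg
      (hι 0) (hιπ 0) (hπ 0)
    exact NakProp.congr E (nak_base B hloc e _)
  | succ n ih =>
    intro M _ _ _
    obtain ⟨m, g, hg⟩ := Module.Finite.exists_fin' A M
    exact nak_step (LinearMap.ker g).subtype g (ι (n + 1)) (π (n + 1)) (ι n)
      (LinearMap.ker g).injective_subtype (LinearMap.exact_subtype_ker_map g) hg
      (hι (n + 1)) (hιπ (n + 1)) (hπ (n + 1)) (hι n) (ih (LinearMap.ker g))

theorem flat_of_tor {A : Type u} [CommRing A]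
    {K F L : Type u} [AddCommGroup K] [AddCommGroup F] [AddCommGroup L]
    [Module A K] [Module A F] [Module A L] [Module.Flat A F]
    (ι : K →ₗ[A] F) (π : F →ₗ[A] L)
    (hι : Function.Injective ι) (hιπ : Function.Exact ι π) (hπ : Function.Surjective π)
    (h : ∀ I : Ideal A, Function.Injective (LinearMap.lTensor (A ⧸ I) ι)) :
    Module.Flat A L := by
  rw [Module.Flat.iff_rTensor_injective']
  intro I
  obtain ⟨E⟩ := torBalance (Submodule.subtype I) (Submodule.mkQ I) ι π
    (Submodule.injective_subtype I) (LinearMap.exact_subtype_mkQ I)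
    (Submodule.mkQ_surjective I) hι hιπ hπ
  have h0 := LinearMap.ker_eq_bot.mpr (h I)
  have hsub : Subsingleton (LinearMap.ker (LinearMap.lTensor (A ⧸ I) ι)) := by
    rw [h0]; infer_instance
  have hsub' : Subsingleton (LinearMap.ker (LinearMap.rTensor L (Submodule.subtype I))) :=
    E.symm.toEquiv.subsingleton
  rw [← LinearMap.ker_eq_bot]
  exact Submodule.subsingleton_iff_eq_bot.mp hsub'

theorem flatDim_chain {A : Type u} [CommRing A]
    (K F : ℕ → Type u) [∀ n, AddCommGroup (K n)] [∀ n, AddCommGroup (F n)]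
    [∀ n, Module A (K n)] [∀ n, Module A (F n)] [∀ n, Module.Flat A (F n)]
    (ι : ∀ n, K (n + 1) →ₗ[A] F n) (π : ∀ n, F n →ₗ[A] K n)
    (hι : ∀ n, Function.Injective (ι n)) (hιπ : ∀ n, Function.Exact (ι n) (π n))
    (hπ : ∀ n, Function.Surjective (π n)) (j : ℕ) :
    ∀ i : ℕ, Module.Flat A (K (i + j)) → FlatDimLE A j (K i) := by
  induction j with
  | zero => intro i h; exact h
  | succ j ih =>
    intro i h
    have h' : Module.Flat A (K (i + 1 + j)) := by
      have : i + 1 + j = i + (j + 1) := by omega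
      rw [this]; exact h
    refine ⟨F i, inferInstance, inferInstance, inferInstance, π i, hπ i, ?_⟩
    exact FlatDimLE.congr A j _ _ ((LinearEquiv.ofInjective (ι i) (hι i)).trans
      (LinearEquiv.ofEq _ _ (LinearMap.exact_iff.mp (hιπ i)).symm)) (ih (i + 1) h')

/-- The vanishing of `Tor` in terms of a projective resolution. -/
theorem tor_exact {A : Type u} [CommRing A] (M N : Type u) [AddCommGroup M] [Module A M]
    [AddCommGroup N] [Module A N] (P : ProjectiveResolution (ModuleCat.of A N)) (i : ℕ)
    (h : TorVanish A (i + 1) M N) :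
    Function.Exact (LinearMap.lTensor M (P.complex.d (i + 2) (i + 1)).hom)
      (LinearMap.lTensor M (P.complex.d (i + 1) i).hom) := by
  let Φ := (MonoidalCategory.tensoringLeft (ModuleCat.{u} A)).obj (ModuleCat.of A M)
  have e := P.isoLeftDerivedObj Φ (i + 1)
  have hz : Limits.IsZero ((Φ.leftDerived (i + 1)).obj (ModuleCat.of A N)) :=
    @ModuleCat.isZero_of_subsingleton _ _ _ h
  have hz' := hz.of_iso e.symm
  have hex : ((Φ.mapHomologicalComplex (ComplexShape.down ℕ)).obj P.complex).ExactAt (i + 1) :=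
    (HomologicalComplex.exactAt_iff_isZero_homology _ _).mpr hz'
  rw [HomologicalComplex.exactAt_iff' _ (i + 2) (i + 1) i (by simp) (by simp)] at hex
  exact (ShortComplex.ShortExact.moduleCat_exact_iff_function_exact _).mp hex

theorem lTensor_injective_of_exact {A : Type u} [CommRing A] (M : Type u)
    [AddCommGroup M] [Module A M] {F₂ F₁ F₀ K : Type u}
    [AddCommGroup F₂] [AddCommGroup F₁] [AddCommGroup F₀] [AddCommGroup K]
    [Module A F₂] [Module A F₁] [Module A F₀] [Module A K]
    (d₂ : F₂ →ₗ[A] F₁) (d₁ : F₁ →ₗ[A] F₀) (π : F₁ →ₗ[A] K) (ι : K →ₗ[A] F₀)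
    (hπ : Function.Surjective π) (hd : d₁ = ι.comp π) (h0 : π.comp d₂ = 0)
    (hx : Function.Exact (LinearMap.lTensor M d₂) (LinearMap.lTensor M d₁)) :
    Function.Injective (LinearMap.lTensor M ι) := by
  rw [← LinearMap.ker_eq_bot, LinearMap.ker_eq_bot']
  intro t ht
  obtain ⟨s, rfl⟩ := LinearMap.lTensor_surjective M hπ t
  have hs : LinearMap.lTensor M d₁ s = 0 := by
    rw [hd, LinearMap.lTensor_comp]
    exact ht
  obtain ⟨r, rfl⟩ := (hx s).mp hs
  rw [← LinearMap.comp_apply, ← LinearMap.lTensor_comp, h0, LinearMap.lTensor_zero,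
    LinearMap.zero_apply]

theorem isTestModule_residueField (A : Type u) [CommRing A] [IsLocalRing A]
    [IsNoetherianRing A] : IsTestModule A (ResidueField A) := by
  intro B _ _ _ _ hloc N _ _ _ _ _ ⟨i₀, hi₀⟩
  let P := ProjectiveResolution.of (ModuleCat.of A N)
  let F : ℕ → Type u := fun n => P.complex.X n
  let d : ∀ n, F (n + 1) →ₗ[A] F n := fun n => (P.complex.d (n + 1) n).hom
  let K : ℕ → Type u := fun n => F n ⧸ LinearMap.range (d n)
  let π : ∀ n, F n →ₗ[A] K n := fun n => (LinearMap.range (d n)).mkQ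
  have hπ : ∀ n, Function.Surjective (π n) := fun n => Submodule.mkQ_surjective _
  have hF : ∀ n, Module.Flat A (F n) := fun n => by
    have : Projective (P.complex.X n) := P.projective n
    have : Module.Projective A (P.complex.X n) := (IsProjective.iff_projective _).mpr this
    exact inferInstanceAs (Module.Flat A (P.complex.X n))
  have hd : ∀ n, Function.Exact (d (n + 1)) (d n) := fun n => by
    have := P.complex_exactAt_succ n
    rw [HomologicalComplex.exactAt_iff' _ (n + 2) (n + 1) n (by simp) (by simp)] at this
    exact (ShortComplex.ShortExact.moduleCat_exact_iff_function_exact _).mp this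
  let ι : ∀ n, K (n + 1) →ₗ[A] F n := fun n =>
    (LinearMap.range (d (n + 1))).liftQ (d n) (by
      rw [← LinearMap.exact_iff.mp (hd n)])
  have hιd : ∀ n x, ι n (π (n + 1) x) = d n x := fun n x => rfl
  have hι : ∀ n, Function.Injective (ι n) := fun n => by
    rw [← LinearMap.ker_eq_bot, LinearMap.ker_eq_bot']
    intro x hx
    obtain ⟨x, rfl⟩ := hπ (n + 1) x
    rw [hιd] at hx
    exact (Submodule.Quotient.mk_eq_zero _).mpr ((hd n x).mp hx)
  have hιπ : ∀ n, Function.Exact (ι n) (π n) := fun n x => by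
    constructor
    · intro hx
      obtain ⟨y, rfl⟩ := (Submodule.Quotient.mk_eq_zero _).mp hx
      exact ⟨π (n + 1) y, hιd n y⟩
    · rintro ⟨y, rfl⟩
      obtain ⟨y, rfl⟩ := hπ (n + 1) y
      exact (Submodule.Quotient.mk_eq_zero _).mpr ⟨y, rfl⟩
  let ε : F 0 →ₗ[A] N := (P.π.f 0).hom
  have hε : Function.Surjective ε := by
    have : Epi (P.π.f 0) := inferInstance
    exact (ModuleCat.epi_iff_surjective _).mp this
  have hdε : Function.Exact (d 0) ε :=
    (ShortComplex.ShortExact.moduleCat_exact_iff_function_exact _).mp P.exact₀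
  let e : K 0 ≃ₗ[A] N :=
    (Submodule.quotEquivOfEq _ _ (LinearMap.exact_iff.mp hdε).symm).trans
      (ε.quotKerEquivOfSurjective hε)
  have hT : Function.Injective (LinearMap.lTensor (A ⧸ maximalIdeal A) (ι i₀)) := by
    have hx := tor_exact (ResidueField A) N P i₀ (hi₀ (i₀ + 1) (by omega))
    exact lTensor_injective_of_exact (ResidueField A) (d (i₀ + 1)) (d i₀) (π (i₀ + 1)) (ι i₀)
      (hπ (i₀ + 1)) rfl (by
        ext x
        exact (Submodule.Quotient.mk_eq_zero _).mpr ⟨x, rfl⟩) hx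
  have hcyc := tor_cyclic_vanish (ι i₀)
    (fun I => nak_tor B hloc K F ι π hι hιπ hπ e i₀ (A ⧸ I)) hT
  have hflat : Module.Flat A (K i₀) := flat_of_tor (ι i₀) (π i₀) (hι i₀) (hιπ i₀) (hπ i₀) hcyc
  refine ⟨i₀, FlatDimLE.congr A i₀ _ _ e (flatDim_chain K F ι π hι hιπ hπ i₀ 0 ?_)⟩
  rw [Nat.zero_add]
  exact hflat

end TorPart

/-- If `A` is a complete intersection noetherian local ring, then there
exists a test module for `A` of finite upper complete intersection dimension; in
particular, the residue field `k` is such a module. -/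
theorem exists_test_module_of_finite_upper_CI_dim_of_complete_intersection
    (A : Type u) [CommRing A] [IsLocalRing A] [IsNoetherianRing A]
    (hA : IsCompleteIntersectionLocalRing A) :
    (∃ (M : Type u) (_ : AddCommGroup M) (_ : Module A M),
        Module.Finite A M ∧ IsTestModule A M ∧ CIStarDimFinite A M) ∧
      IsTestModule A (ResidueField A) ∧ CIStarDimFinite A (ResidueField A) := by
  have ht : IsTestModule A (ResidueField A) := isTestModule_residueField A
  have hc : CIStarDimFinite A (ResidueField A) := ciStar_residueField A hA
  have hf : Module.Finite A (ResidueField A) :=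
    Module.Finite.of_surjective (Algebra.linearMap A (ResidueField A)) residue_surjective
  exact ⟨⟨ResidueField A, inferInstance, inferInstance, hf, ht, hc⟩, ht, hc⟩
end

section
/- Let (A, m, k) be a noetherian local ring and let M be a test module for A. If M has finite Gorenstein dimension (G-dim_A(M) < ∞), then A is a Gorenstein ring. (No assumption that A has a dualizing complex is needed.) -/
open CategoryTheory IsLocalRing

universe u

open scoped TensorProduct

/-- Vanishing of the Ext group. -/
def EV (A : Type u) [CommRing A] (M : Type u) [AddCommGroup M] [Module A M]
    (N : Type u) [AddCommGroup N] [Module A N] (n : ℕ) : Prop :=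
  ∀ e : Abelian.Ext (ModuleCat.of A M) (ModuleCat.of A N) n, e = 0

section
variable {A : Type u} [CommRing A]

theorem ev_of_extVanish {M N : Type u} [AddCommGroup M] [Module A M] [AddCommGroup N] [Module A N]
    (p : ℕ) (h : ExtVanish A (p+1) M N) : EV A M N (p+1) := by
  intro e
  let P := projectiveResolution (ModuleCat.of A M)
  have iso := P.isoExt (R := A) (p+1) (ModuleCat.of A N)
  have hz : Limits.IsZero ((P.complex.linearYonedaObj A (ModuleCat.of A N)).homology (p+1)) := by
    refine Limits.IsZero.of_iso ?_ iso.symm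
    have : Subsingleton (((Ext A (ModuleCat.{u} A) (p+1)).obj (Opposite.op (ModuleCat.of A M))).obj
      (ModuleCat.of A N)) := h
    exact ModuleCat.isZero_of_subsingleton _
  rw [← HomologicalComplex.exactAt_iff_isZero_homology,
    HomologicalComplex.exactAt_iff' _ p (p+1) (p+2) (by simp) (by simp),
    ShortComplex.moduleCat_exact_iff] at hz
  obtain ⟨f, hf, rfl⟩ := P.extMk_surjective e (p+2) rfl
  rw [P.extMk_eq_zero_iff f (p+2) rfl hf p rfl]
  obtain ⟨g, hg⟩ := hz f hf
  exact ⟨g, hg⟩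

theorem torVanish_of_ev {M N : Type u} [AddCommGroup M] [Module A M] [AddCommGroup N] [Module A N]
    (p : ℕ) (h : EV A N (CharacterModule M) (p+1)) : TorVanish A (p+1) M N := by
  let P := projectiveResolution (ModuleCat.of A N)
  have iso := P.isoLeftDerivedObj ((MonoidalCategory.tensoringLeft (ModuleCat.{u} A)).obj (ModuleCat.of A M)) (p+1)
  have key : Limits.IsZero (((((MonoidalCategory.tensoringLeft (ModuleCat.{u} A)).obj (ModuleCat.of A M)).mapHomologicalComplex _).obj P.complex).homology (p+1)) := by
    rw [← HomologicalComplex.exactAt_iff_isZero_homology,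
      HomologicalComplex.exactAt_iff' _ (p+2) (p+1) p (by simp) (by simp),
      ShortComplex.moduleCat_exact_iff]
    intro t ht
    let d1 : TensorProduct A M (P.complex.X (p+2)) →ₗ[A] TensorProduct A M (P.complex.X (p+1)) :=
      (P.complex.d (p+2) (p+1)).hom.lTensor M
    let d0 : TensorProduct A M (P.complex.X (p+1)) →ₗ[A] TensorProduct A M (P.complex.X p) :=
      (P.complex.d (p+1) p).hom.lTensor M
    change TensorProduct A M (P.complex.X (p+1)) at t
    change d0 t = 0 at ht
    change ∃ s, d1 s = t
    by_contra hcon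
    have hne : (LinearMap.range d1).mkQ t ≠ 0 := by
      intro h0
      rw [Submodule.mkQ_apply, Submodule.Quotient.mk_eq_zero] at h0
      exact hcon h0
    obtain ⟨χ, hχ⟩ := CharacterModule.exists_character_apply_ne_zero_of_ne_zero hne
    have hχd : ∀ s, χ ((LinearMap.range d1).mkQ (d1 s)) = 0 := by
      intro s
      have : (LinearMap.range d1).mkQ (d1 s) = 0 := by
        rw [Submodule.mkQ_apply, Submodule.Quotient.mk_eq_zero]; exact ⟨s, rfl⟩
      rw [this]; exact map_zero χ
    let χ' : CharacterModule (TensorProduct A (P.complex.X (p+1)) M) :=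
      CharacterModule.dual ((LinearMap.range d1).mkQ ∘ₗ (TensorProduct.comm A _ M).toLinearMap) χ
    let f : P.complex.X (p+1) →ₗ[A] CharacterModule M := CharacterModule.curry χ'
    have hf : P.complex.d (p+2) (p+1) ≫ ModuleCat.ofHom f = 0 := by
      ext x m
      exact hχd (m ⊗ₜ[A] x)
    obtain ⟨g, hg⟩ := (P.extMk_eq_zero_iff (ModuleCat.ofHom f) (p+2) rfl hf p rfl).1 (h _)
    have hfac : ∀ y : TensorProduct A M (P.complex.X (p+1)),
        χ ((LinearMap.range d1).mkQ y) = CharacterModule.uncurry (B := M) (R := A) g.hom (TensorProduct.comm A _ _ (d0 y)) := by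
      intro y
      induction y with
      | zero => simp only [map_zero]
      | add a b ha hb => simp only [map_add, ha, hb]
      | tmul m q =>
        have := congrArg (fun φ => (φ.hom q : CharacterModule M) m) hg
        exact this.symm
    apply hχ
    rw [hfac, ht]
    simp only [map_zero]
  have : TorVanish A (p+1) M N ↔ Subsingleton (((Tor (ModuleCat.{u} A) (p+1)).obj (ModuleCat.of A M)).obj (ModuleCat.of A N)) := Iff.rfl
  rw [this, ← ModuleCat.isZero_iff_subsingleton]
  exact key.of_iso iso
end

section
open Abelian.Ext
variable {A : Type u} [CommRing A]
variable {X₁ X₂ X₃ Y : Type u} [AddCommGroup X₁] [Module A X₁] [AddCommGroup X₂] [Module A X₂]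
  [AddCommGroup X₃] [Module A X₃] [AddCommGroup Y] [Module A Y]

theorem ses_mod {f : X₁ →ₗ[A] X₂} {g : X₂ →ₗ[A] X₃}
    (hf : Function.Injective f) (he : Function.Exact f g) (hg : Function.Surjective g) :
    (ModuleCat.shortComplexOfCompEqZero f g he.linearMap_comp_eq_zero).ShortExact :=
  ModuleCat.shortComplex_shortExact _ he hf hg

theorem ev_c3 {f : X₁ →ₗ[A] X₂} {g : X₂ →ₗ[A] X₃}
    (hf : Function.Injective f) (he : Function.Exact f g) (hg : Function.Surjective g) {n : ℕ}
    (h1 : EV A X₁ Y n) (h2 : EV A X₂ Y (n+1)) : EV A X₃ Y (n+1) := by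
  intro e
  obtain ⟨x, rfl⟩ := contravariant_sequence_exact₃ (ses_mod hf he hg) (ModuleCat.of A Y) e
    (h2 _) (add_comm 1 n)
  rw [show x = 0 from h1 x]; simp

theorem ev_c2 {f : X₁ →ₗ[A] X₂} {g : X₂ →ₗ[A] X₃}
    (hf : Function.Injective f) (he : Function.Exact f g) (hg : Function.Surjective g) {n : ℕ}
    (h1 : EV A X₁ Y n) (h3 : EV A X₃ Y n) : EV A X₂ Y n := by
  intro e
  obtain ⟨x, rfl⟩ := contravariant_sequence_exact₂ (ses_mod hf he hg) (ModuleCat.of A Y) e (h1 _)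
  rw [show x = 0 from h3 x]; simp

theorem ev_c1 {f : X₁ →ₗ[A] X₂} {g : X₂ →ₗ[A] X₃}
    (hf : Function.Injective f) (he : Function.Exact f g) (hg : Function.Surjective g) {n : ℕ}
    (h2 : EV A X₂ Y n) (h3 : EV A X₃ Y (n+1)) : EV A X₁ Y n := by
  intro e
  obtain ⟨x, rfl⟩ := contravariant_sequence_exact₁ (ses_mod hf he hg) (ModuleCat.of A Y) e
    (add_comm 1 n) (h3 _)
  rw [show x = 0 from h2 x]; simp

theorem ev_c_lift {f : X₁ →ₗ[A] X₂} {g : X₂ →ₗ[A] X₃}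
    (hf : Function.Injective f) (he : Function.Exact f g) (hg : Function.Surjective g)
    (h3 : EV A X₃ Y 1) (h : X₁ →ₗ[A] Y) : ∃ h' : X₂ →ₗ[A] Y, h' ∘ₗ f = h := by
  obtain ⟨x, hx⟩ := contravariant_sequence_exact₁ (ses_mod hf he hg) (ModuleCat.of A Y)
    (mk₀ (ModuleCat.ofHom h)) (n₁ := 1) rfl (h3 _)
  obtain ⟨x, rfl⟩ := (mk₀_bijective _ _).2 x
  rw [mk₀_comp_mk₀] at hx
  have := (mk₀_bijective _ _).1 hx
  refine ⟨x.hom, ?_⟩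
  have := congrArg ModuleCat.Hom.hom this
  exact this

theorem ev_c_one {f : X₁ →ₗ[A] X₂} {g : X₂ →ₗ[A] X₃}
    (hf : Function.Injective f) (he : Function.Exact f g) (hg : Function.Surjective g)
    (h2 : EV A X₂ Y 1) (H : ∀ h : X₁ →ₗ[A] Y, ∃ h' : X₂ →ₗ[A] Y, h' ∘ₗ f = h) : EV A X₃ Y 1 := by
  intro e
  obtain ⟨x, rfl⟩ := contravariant_sequence_exact₃ (ses_mod hf he hg) (ModuleCat.of A Y) e
    (h2 _) (n₀ := 0) rfl
  obtain ⟨x, rfl⟩ := (mk₀_bijective _ _).2 x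
  obtain ⟨h', hh⟩ := H x.hom
  have : x = (ModuleCat.shortComplexOfCompEqZero f g he.linearMap_comp_eq_zero).f ≫
      ModuleCat.ofHom h' := by
    ext1; exact hh.symm
  rw [this, ← mk₀_comp_mk₀]
  rw [ShortComplex.ShortExact.extClass_comp_assoc]

theorem ev_v1 {f : X₁ →ₗ[A] X₂} {g : X₂ →ₗ[A] X₃}
    (hf : Function.Injective f) (he : Function.Exact f g) (hg : Function.Surjective g) {n : ℕ}
    (h3 : EV A Y X₃ n) (h2 : EV A Y X₂ (n+1)) : EV A Y X₁ (n+1) := by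
  intro e
  obtain ⟨x, rfl⟩ := covariant_sequence_exact₁ (ModuleCat.of A Y) (ses_mod hf he hg) e
    (h2 _) rfl
  rw [show x = 0 from h3 x]; simp

theorem ev_v2 {f : X₁ →ₗ[A] X₂} {g : X₂ →ₗ[A] X₃}
    (hf : Function.Injective f) (he : Function.Exact f g) (hg : Function.Surjective g) {n : ℕ}
    (h1 : EV A Y X₁ n) (h3 : EV A Y X₃ n) : EV A Y X₂ n := by
  intro e
  obtain ⟨x, rfl⟩ := covariant_sequence_exact₂ (ModuleCat.of A Y) (ses_mod hf he hg) e (h3 _)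
  rw [show x = 0 from h1 x]; simp

theorem ev_v3 {f : X₁ →ₗ[A] X₂} {g : X₂ →ₗ[A] X₃}
    (hf : Function.Injective f) (he : Function.Exact f g) (hg : Function.Surjective g) {n : ℕ}
    (h2 : EV A Y X₂ n) (h1 : EV A Y X₁ (n+1)) : EV A Y X₃ n := by
  intro e
  obtain ⟨x, rfl⟩ := covariant_sequence_exact₃ (ModuleCat.of A Y) (ses_mod hf he hg) e rfl (h1 _)
  rw [show x = 0 from h2 x]; simp

theorem ev_v_lift {f : X₁ →ₗ[A] X₂} {g : X₂ →ₗ[A] X₃}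
    (hf : Function.Injective f) (he : Function.Exact f g) (hg : Function.Surjective g)
    (h1 : EV A Y X₁ 1) (h : Y →ₗ[A] X₃) : ∃ h' : Y →ₗ[A] X₂, g ∘ₗ h' = h := by
  obtain ⟨x, hx⟩ := covariant_sequence_exact₃ (ModuleCat.of A Y) (ses_mod hf he hg)
    (mk₀ (ModuleCat.ofHom h)) (n₁ := 1) rfl (h1 _)
  obtain ⟨x, rfl⟩ := (mk₀_bijective _ _).2 x
  rw [mk₀_comp_mk₀] at hx
  have := (mk₀_bijective _ _).1 hx
  refine ⟨x.hom, ?_⟩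
  have := congrArg ModuleCat.Hom.hom this
  exact this

theorem ev_v_one {f : X₁ →ₗ[A] X₂} {g : X₂ →ₗ[A] X₃}
    (hf : Function.Injective f) (he : Function.Exact f g) (hg : Function.Surjective g)
    (h2 : EV A Y X₂ 1) (H : ∀ h : Y →ₗ[A] X₃, ∃ h' : Y →ₗ[A] X₂, g ∘ₗ h' = h) : EV A Y X₁ 1 := by
  intro e
  obtain ⟨x, rfl⟩ := covariant_sequence_exact₁ (ModuleCat.of A Y) (ses_mod hf he hg) e
    (h2 _) (n₀ := 0) rfl
  obtain ⟨x, rfl⟩ := (mk₀_bijective _ _).2 x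
  obtain ⟨h', hh⟩ := H x.hom
  have : x = ModuleCat.ofHom h' ≫
      (ModuleCat.shortComplexOfCompEqZero f g he.linearMap_comp_eq_zero).g := by
    ext1; exact hh.symm
  rw [this, ← mk₀_comp_mk₀, comp_assoc_of_second_deg_zero,
    ShortComplex.ShortExact.comp_extClass, comp_zero]

theorem ev_of_proj [Module.Projective A X₁] (n : ℕ) : EV A X₁ Y (n+1) := by
  intro e
  have : Projective (ModuleCat.of A X₁) := (IsProjective.iff_projective _ ).1 inferInstance
  exact Abelian.Ext.eq_zero_of_projective e

theorem ev_of_inj [Module.Injective A Y] (n : ℕ) : EV A X₁ Y (n+1) := by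
  intro e
  have : Injective (ModuleCat.of A Y) := Module.injective_object_of_injective_module A Y
  exact Abelian.Ext.eq_zero_of_injective e

/-- `Ext` vanishing transfers along linear equivalences. -/
theorem ev_congr_left (e : X₁ ≃ₗ[A] X₂) {n : ℕ} (h : EV A X₁ Y n) : EV A X₂ Y n := by
  refine ev_c2 (f := e.toLinearMap) (g := (0 : X₂ →ₗ[A] PUnit.{u+1})) e.injective ?_ ?_ h ?_
  · intro x; simp [e.surjective x]
  · intro x; exact ⟨0, Subsingleton.elim _ _⟩
  · intro x
    have : Limits.IsZero (ModuleCat.of A PUnit.{u+1}) := ModuleCat.isZero_of_subsingleton _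
    have : (Abelian.Ext.mk₀ (𝟙 (ModuleCat.of A PUnit.{u+1}))).comp x (zero_add n) = x := by simp
    rw [← this, show (𝟙 (ModuleCat.of A PUnit.{u+1})) = 0 from Limits.IsZero.eq_of_src ‹_› _ _]
    simp

theorem ev_of_subsingleton [Subsingleton X₁] {n : ℕ} : EV A X₁ Y n := by
  intro x
  have : Limits.IsZero (ModuleCat.of A X₁) := ModuleCat.isZero_of_subsingleton _
  have : (Abelian.Ext.mk₀ (𝟙 (ModuleCat.of A X₁))).comp x (zero_add n) = x := by simp
  rw [← this, show (𝟙 (ModuleCat.of A X₁)) = 0 from Limits.IsZero.eq_of_src ‹_› _ _]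
  simp

theorem ker_exact (f : X₁ →ₗ[A] X₂) : Function.Exact (LinearMap.ker f).subtype f := by
  intro x; simp

theorem ev_of_gdim (n : ℕ) : ∀ (M : Type u) [AddCommGroup M] [Module A M], GDimLE A n M →
    ∀ i, n < i → EV A M A i := by
  induction n with
  | zero =>
    intro M _ _ h i hi
    obtain ⟨p, rfl⟩ : ∃ p, i = p + 1 := ⟨i - 1, by omega⟩
    exact ev_of_extVanish p (h.2.1 _ (by omega))
  | succ n ih =>
    intro M _ _ h i hi
    obtain ⟨T, _, _, hT, f, hf, hK⟩ := h
    obtain ⟨p, rfl⟩ : ∃ p, i = p + 1 := ⟨i - 1, by omega⟩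
    refine ev_c3 (LinearMap.ker f).injective_subtype (ker_exact f) hf (ih _ hK p (by omega)) ?_
    exact ev_of_extVanish p (hT.2.1 _ (by omega))

end

section
variable {A : Type u} [CommRing A]
variable {X X₁ X₂ X₃ Y : Type u} [AddCommGroup X₁] [Module A X₁] [AddCommGroup X₂] [Module A X₂]
  [AddCommGroup X₃] [Module A X₃] [AddCommGroup Y] [Module A Y] [AddCommGroup X] [Module A X]

theorem char_exact {f : X₁ →ₗ[A] X₂} {g : X₂ →ₗ[A] X₃}
    (he : Function.Exact f g) (hg : Function.Surjective g) :
    Function.Exact (CharacterModule.dual (R := A) g) (CharacterModule.dual (R := A) f) := by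
  intro φ
  constructor
  · intro h
    have hk : ∀ x, g x = 0 → φ x = 0 := by
      intro x hx
      obtain ⟨y, rfl⟩ := (he x).1 hx
      exact DFunLike.congr_fun h y
    refine ⟨(QuotientAddGroup.lift (AddMonoidHom.ker g.toAddMonoidHom) (φ : X₂ →+ _)
      (fun x hx => hk x hx)).comp
        (QuotientAddGroup.quotientKerEquivOfSurjective g.toAddMonoidHom hg).symm.toAddMonoidHom, ?_⟩
    refine DFunLike.ext _ _ fun x => ?_
    change (QuotientAddGroup.lift (AddMonoidHom.ker g.toAddMonoidHom) (φ : X₂ →+ _)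
      (fun x hx => hk x hx))
      ((QuotientAddGroup.quotientKerEquivOfSurjective g.toAddMonoidHom hg).symm (g x)) = φ x
    have : (QuotientAddGroup.quotientKerEquivOfSurjective g.toAddMonoidHom hg).symm (g x) =
      (QuotientAddGroup.mk x) := by
      rw [AddEquiv.symm_apply_eq]; rfl
    rw [this]; rfl
  · rintro ⟨ψ, rfl⟩
    refine DFunLike.ext _ _ fun x => ?_
    change ψ (g (f x)) = 0
    rw [he.apply_apply_eq_zero, map_zero]

theorem char_lift_iff (f : X₁ →ₗ[A] X₂) :
    (∀ h : X →ₗ[A] CharacterModule X₁, ∃ h' : X →ₗ[A] CharacterModule X₂,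
      CharacterModule.dual f ∘ₗ h' = h) ↔ Function.Injective (f.lTensor X) := by
  rw [← CharacterModule.dual_surjective_iff_injective]
  have key : ∀ h' : X →ₗ[A] CharacterModule X₂,
      CharacterModule.homEquiv (CharacterModule.dual f ∘ₗ h') =
        CharacterModule.dual (f.lTensor X) (CharacterModule.homEquiv h') := by
    intro h'
    apply CharacterModule.homEquiv.symm.injective
    ext x y
    rfl
  constructor
  · intro H c
    obtain ⟨h', hh⟩ := H (CharacterModule.homEquiv.symm c)
    refine ⟨CharacterModule.homEquiv h', ?_⟩
    rw [← key, hh]; simp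
  · intro H h
    obtain ⟨c, hc⟩ := H (CharacterModule.homEquiv h)
    refine ⟨CharacterModule.homEquiv.symm c, ?_⟩
    apply CharacterModule.homEquiv.injective
    rw [key, LinearEquiv.apply_symm_apply, hc]

theorem ev_char_one_iff {f : X₁ →ₗ[A] X₂} {g : X₂ →ₗ[A] X₃} [Module.Flat A X₂]
    (hf : Function.Injective f) (he : Function.Exact f g) (hg : Function.Surjective g) :
    EV A X (CharacterModule X₃) 1 ↔ Function.Injective (f.lTensor X) := by
  have : Module.Injective A (CharacterModule X₂) :=
    Module.Flat.iff_characterModule_injective.1 inferInstance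
  rw [← char_lift_iff]
  exact ⟨fun h k => ev_v_lift (CharacterModule.dual_injective_of_surjective g hg)
    (char_exact he hg) (CharacterModule.dual_surjective_of_injective f hf) h k,
    fun h => ev_v_one (CharacterModule.dual_injective_of_surjective g hg)
    (char_exact he hg) (CharacterModule.dual_surjective_of_injective f hf) (ev_of_inj 0) h⟩

theorem ev_char_succ_iff {f : X₁ →ₗ[A] X₂} {g : X₂ →ₗ[A] X₃} [Module.Flat A X₂]
    (hf : Function.Injective f) (he : Function.Exact f g) (hg : Function.Surjective g) (n : ℕ) :
    EV A X (CharacterModule X₃) (n+2) ↔ EV A X (CharacterModule X₁) (n+1) := by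
  have : Module.Injective A (CharacterModule X₂) :=
    Module.Flat.iff_characterModule_injective.1 inferInstance
  exact ⟨fun h => ev_v3 (CharacterModule.dual_injective_of_surjective g hg)
    (char_exact he hg) (CharacterModule.dual_surjective_of_injective f hf) (ev_of_inj n) h,
    fun h => ev_v1 (CharacterModule.dual_injective_of_surjective g hg)
    (char_exact he hg) (CharacterModule.dual_surjective_of_injective f hf) h (ev_of_inj _)⟩

theorem ev_flat [Module.Flat A X] (n : ℕ) : ∀ (Y : Type u) [AddCommGroup Y] [Module A Y],
    EV A X (CharacterModule Y) (n+1) := by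
  induction n with
  | zero =>
    intro Y _ _
    have hs : Function.Surjective (Finsupp.linearCombination A (id : Y → Y)) :=
      Finsupp.linearCombination_surjective A Function.surjective_id
    rw [ev_char_one_iff (Submodule.injective_subtype _) (ker_exact _) hs]
    exact Module.Flat.lTensor_preserves_injective_linearMap _ (Submodule.injective_subtype _)
  | succ n ih =>
    intro Y _ _
    have hs : Function.Surjective (Finsupp.linearCombination A (id : Y → Y)) :=
      Finsupp.linearCombination_surjective A Function.surjective_id
    rw [ev_char_succ_iff (Submodule.injective_subtype _) (ker_exact _) hs]
    exact ih _

theorem ev_of_flatDim (n : ℕ) : ∀ (N : Type u) [AddCommGroup N] [Module A N], FlatDimLE A n N →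
    ∀ (Y : Type u) [AddCommGroup Y] [Module A Y], ∀ i, n < i → EV A N (CharacterModule Y) i := by
  induction n with
  | zero =>
    intro N _ _ h Y _ _ i hi
    obtain ⟨p, rfl⟩ : ∃ p, i = p + 1 := ⟨i - 1, by omega⟩
    have : Module.Flat A N := h
    exact ev_flat p Y
  | succ n ih =>
    intro N _ _ h Y _ _ i hi
    obtain ⟨T, _, _, hT, f, hf, hK⟩ := h
    obtain ⟨p, rfl⟩ : ∃ p, i = p + 1 := ⟨i - 1, by omega⟩
    exact ev_c3 (LinearMap.ker f).injective_subtype (ker_exact f) hf (ih _ hK Y p (by omega))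
      (ev_flat p Y)

end

section
variable {A : Type u} [CommRing A]

theorem artinian_of_torsion {Y : Type u} [AddCommGroup Y] [Module A Y] (x : A)
    (ht : ∀ y : Y, ∃ n : ℕ, x ^ n • y = 0)
    (ha : IsArtinian A (LinearMap.ker (LinearMap.lsmul A Y x))) : IsArtinian A Y := by
  rw [← monotone_stabilizes_iff_artinian]
  intro f
  set K := LinearMap.ker (LinearMap.lsmul A Y x) with hK
  let Z : ℕ → Submodule A Y := fun n => OrderDual.ofDual (f n)
  have hZ : ∀ {a b : ℕ}, a ≤ b → Z b ≤ Z a := fun h => f.monotone h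
  let L : ℕ → ℕ → Submodule A K := fun n i =>
    ((Z n).map (LinearMap.lsmul A Y (x ^ i))).comap K.subtype
  have hL : ∀ {n n' i i' : ℕ}, n ≤ n' → i ≤ i' → L n' i' ≤ L n i := by
    rintro n n' i i' hn hi y ⟨z, hz, hzy⟩
    refine ⟨x ^ (i' - i) • z, Submodule.smul_mem _ _ (hZ hn hz), ?_⟩
    rw [← hzy]
    simp only [LinearMap.lsmul_apply, smul_smul, ← pow_add]
    congr 2; omega
  obtain ⟨N0, hN0⟩ := IsArtinian.monotone_stabilizes (R := A) (M := K)
    ⟨fun n => OrderDual.toDual (L n n), fun a b h => hL h h⟩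
  have hN0' : ∀ m, N0 ≤ m → L N0 N0 = L m m := fun m hm => hN0 m hm
  have h1 : ∀ i, ∃ N, ∀ m, N ≤ m → L N i = L m i := by
    intro i
    exact IsArtinian.monotone_stabilizes (R := A) (M := K)
      ⟨fun n => OrderDual.toDual (L n i), fun a b h => hL h le_rfl⟩
  choose g hg using h1
  let N := N0 + ∑ i ∈ Finset.range N0, g i
  have hN : ∀ n, N ≤ n → ∀ i, L N i ≤ L n i := by
    intro n hn i
    by_cases hi : i < N0
    · have : g i ≤ N := le_trans (Finset.single_le_sum (f := g) (fun _ _ => Nat.zero_le _)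
        (Finset.mem_range.2 hi)) (Nat.le_add_left _ _)
      rw [← hg i N this, ← hg i n (this.trans hn)]
    · push Not at hi
      have h0 : N0 ≤ N := Nat.le_add_right _ _
      calc L N i ≤ L N0 N0 := hL h0 hi
        _ = L (max n i) (max n i) := hN0' _ (by omega)
        _ ≤ L n i := hL (le_max_left _ _) (le_max_right _ _)
  refine ⟨N, fun n hn => ?_⟩
  change Z N = Z n
  refine le_antisymm ?_ (hZ hn)
  have key : ∀ i, ∀ y ∈ Z N, x ^ i • y = 0 → y ∈ Z n := by
    intro i
    induction i with
    | zero => intro y _ h; simp at h; subst h; exact zero_mem _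
    | succ i ih =>
      intro y hy h
      have hk : x ^ i • y ∈ K := by
        rw [hK, LinearMap.mem_ker, LinearMap.lsmul_apply, smul_smul, ← pow_succ']; exact h
      have : (⟨x ^ i • y, hk⟩ : K) ∈ L N i := ⟨y, hy, rfl⟩
      obtain ⟨z, hz, hzy⟩ := hN n hn i this
      have hzy' : x ^ i • z = x ^ i • y := hzy
      have := ih (y - z) (sub_mem hy (hZ hn hz)) (by rw [smul_sub, hzy', sub_self])
      simpa using add_mem this hz
  intro y hy
  obtain ⟨i, hi⟩ := ht y
  exact key i y hy hi

theorem artinian_of_torsion_list (l : List A) : ∀ (Y : Type u) [AddCommGroup Y] [Module A Y],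
    (∀ x ∈ l, ∀ y : Y, ∃ n : ℕ, x ^ n • y = 0) →
    (∀ Z : Submodule A Y, (∀ z ∈ Z, ∀ x ∈ l, x • z = 0) → IsArtinian A Z) → IsArtinian A Y := by
  induction l with
  | nil =>
    intro Y _ _ _ h
    have : IsArtinian A (⊤ : Submodule A Y) := h ⊤ (by simp)
    exact isArtinian_of_linearEquiv (Submodule.topEquiv (R := A) (M := Y))
  | cons x l ih =>
    intro Y _ _ ht h
    apply artinian_of_torsion x (ht x (by simp))
    apply ih
    · intro x' hx' y
      obtain ⟨n, hn⟩ := ht x' (by simp [hx']) y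
      exact ⟨n, Subtype.ext hn⟩
    · intro Z hZ
      have := h (Z.map (Submodule.subtype _)) (by
        rintro _ ⟨z, hz, rfl⟩ x' hx'
        rcases List.mem_cons.1 hx' with rfl | hx'
        · exact z.2
        · exact congrArg Subtype.val (hZ z hz x' hx'))
      exact isArtinian_of_linearEquiv
        (Submodule.equivSubtypeMap _ Z).symm

variable [IsLocalRing A]

/-- every nonzero element of the submodule has `s` as a multiple -/
def EssOver {J : Type u} [AddCommGroup J] [Module A J] (s : J) (E : Submodule A J) : Prop :=
  s ∈ E ∧ ∀ x ∈ E, x ≠ 0 → ∃ a : A, a • x = s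

theorem exists_inj_soc : ∃ (J : Type u) (_ : AddCommGroup J) (_ : Module A J),
    Module.Injective A J ∧ ∃ s : J, s ≠ 0 ∧ ∀ x ∈ maximalIdeal A, x • s = 0 := by
  let J := Injective.under (ModuleCat.of A (ResidueField A))
  let i := Injective.ι (ModuleCat.of A (ResidueField A))
  refine ⟨J, inferInstance, inferInstance, Module.injective_module_of_injective_object A J (inj := (inferInstance : Injective
      (Injective.under (ModuleCat.of A (ResidueField A))))),
    i.hom (1 : ResidueField A), ?_, ?_⟩
  · intro h
    have hi : Function.Injective i.hom := (ModuleCat.mono_iff_injective i).1 inferInstance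
    exact one_ne_zero (α := ResidueField A) (hi (h.trans (map_zero _).symm))
  · intro x hx
    rw [← map_smul]
    have : x • (1 : ResidueField A) = 0 := by
      rw [Algebra.smul_def, mul_one]
      exact (residue_eq_zero_iff x).2 hx
    exact (congrArg _ this).trans (map_zero _)

theorem exists_hull : ∃ (E : Type u) (_ : AddCommGroup E) (_ : Module A E),
    Module.Injective A E ∧ ∃ s : E, s ≠ 0 ∧ (∀ x ∈ maximalIdeal A, x • s = 0) ∧
      ∀ x : E, x ≠ 0 → ∃ a : A, a • x = s := by
  obtain ⟨J, _, _, hJ, s, hs0, hs⟩ := exists_inj_soc (A := A)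
  obtain ⟨E, hE, hmax⟩ : ∃ E : Submodule A J, EssOver s E ∧ ∀ E', EssOver s E' → E ≤ E' → E' ≤ E := by
    obtain ⟨E, -, hE⟩ := zorn_le_nonempty₀ {E : Submodule A J | EssOver s E} (by
      intro c hc hch y hy
      refine ⟨sSup c, ⟨?_, ?_⟩, fun z hz => le_sSup hz⟩
      · exact (le_sSup hy) (hc hy).1
      · intro x hx hx0
        rw [Submodule.mem_sSup_of_directed ⟨y, hy⟩ hch.directedOn] at hx
        obtain ⟨z, hz, hxz⟩ := hx
        exact (hc hz).2 x hxz hx0) (Submodule.span A {s}) (by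
      refine ⟨Submodule.mem_span_singleton_self s, ?_⟩
      intro x hx hx0
      obtain ⟨a, rfl⟩ := Submodule.mem_span_singleton.1 hx
      have : IsUnit a := by
        by_contra h
        exact hx0 (hs a h)
      obtain ⟨u, rfl⟩ := this
      exact ⟨(u⁻¹ : Aˣ), by rw [smul_smul]; simp⟩)
    exact ⟨E, hE.1, fun E' h1 h2 => hE.2 h1 h2⟩
  obtain ⟨C, hC, hCmax⟩ : ∃ C : Submodule A J, s ∉ C ∧ ∀ C' : Submodule A J, s ∉ C' → C ≤ C' → C' ≤ C := by
    obtain ⟨C, -, hC⟩ := zorn_le_nonempty₀ {C : Submodule A J | s ∉ C} (by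
      intro c hc hch y hy
      refine ⟨sSup c, ?_, fun z hz => le_sSup hz⟩
      intro hx
      rw [Submodule.mem_sSup_of_directed ⟨y, hy⟩ hch.directedOn] at hx
      obtain ⟨z, hz, hxz⟩ := hx
      exact hc hz hxz) ⊥ (by simpa using hs0)
    exact ⟨C, hC.1, fun E' h1 h2 => hC.2 h1 h2⟩
  have hmul : ∀ x, x ∉ C → ∃ a : A, a • x - s ∈ C := by
    intro x hx
    by_contra! h
    refine hx (hCmax (C ⊔ Submodule.span A {x}) ?_ le_sup_left
      ((le_sup_right : _ ≤ C ⊔ Submodule.span A {x}) (Submodule.mem_span_singleton_self x)))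
    intro h'
    obtain ⟨c, hc, y, hy, hcy⟩ := Submodule.mem_sup.1 h'
    obtain ⟨a, rfl⟩ := Submodule.mem_span_singleton.1 hy
    apply h a
    rw [← hcy]; simpa using hc
  let j : E →ₗ[A] J ⧸ C := C.mkQ ∘ₗ E.subtype
  have hj : Function.Injective j := by
    rw [injective_iff_map_eq_zero]
    intro e he
    have he' : (e : J) ∈ C := (Submodule.Quotient.mk_eq_zero C).1 he
    by_contra hne
    obtain ⟨a, ha⟩ := hE.2 e e.2 (fun h => hne (Subtype.ext h))
    exact hC (ha ▸ C.smul_mem a he')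
  obtain ⟨φ, hφ⟩ := hJ.out j hj E.subtype
  have hφs : φ (C.mkQ s) = s := hφ ⟨s, hE.1⟩
  have hrE : LinearMap.range φ ≤ E := by
    apply hmax
    · refine ⟨⟨_, hφs⟩, ?_⟩
      rintro _ ⟨y, rfl⟩ hy0
      obtain ⟨x, rfl⟩ := C.mkQ_surjective y
      have hx : x ∉ C := by
        intro hx
        apply hy0
        rw [show C.mkQ x = 0 from (Submodule.Quotient.mk_eq_zero C).2 hx, map_zero]
      obtain ⟨a, ha⟩ := hmul x hx
      refine ⟨a, ?_⟩
      have h0 : C.mkQ (a • x - s) = 0 := (Submodule.Quotient.mk_eq_zero C).2 ha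
      rw [map_sub, sub_eq_zero, map_smul] at h0
      rw [← map_smul, h0, hφs]
    · intro e he
      exact ⟨_, hφ ⟨e, he⟩⟩
  let r : J →ₗ[A] E := (φ ∘ₗ C.mkQ).codRestrict E (fun x => hrE ⟨_, rfl⟩)
  have hr : ∀ e : E, r e = e := fun e => Subtype.ext (hφ e)
  refine ⟨E, inferInstance, inferInstance, ⟨?_⟩, ⟨s, hE.1⟩, ?_, ?_, ?_⟩
  · intro X Y _ _ _ _ f hf g
    obtain ⟨h, hh⟩ := hJ.out f hf (E.subtype ∘ₗ g)
    exact ⟨r ∘ₗ h, fun x => by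
      rw [LinearMap.comp_apply, hh]; exact hr _⟩
  · intro h; exact hs0 (congrArg Subtype.val h)
  · intro x hx; exact Subtype.ext (hs x hx)
  · intro x hx
    obtain ⟨a, ha⟩ := hE.2 x x.2 (fun h => hx (Subtype.ext h))
    exact ⟨a, Subtype.ext ha⟩

theorem exists_E [IsNoetherianRing A] : ∃ (E : Type u) (_ : AddCommGroup E) (_ : Module A E),
    Module.Injective A E ∧ IsArtinian A E ∧
      (∀ x ∈ maximalIdeal A, ∀ e : E, ∃ n : ℕ, x ^ n • e = 0) ∧
      ∃ s : E, s ≠ 0 ∧ ∀ x ∈ maximalIdeal A, x • s = 0 := by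
  obtain ⟨E, _, _, hinj, s, hs0, hs, hess⟩ := exists_hull (A := A)
  have ht : ∀ x ∈ maximalIdeal A, ∀ e : E, ∃ n : ℕ, x ^ n • e = 0 := by
    intro x hx e
    by_contra! hne
    obtain ⟨n, hn⟩ := monotone_stabilizes_iff_noetherian.2 (inferInstance : IsNoetherian A A)
      ⟨fun n => LinearMap.ker (LinearMap.toSpanSingleton A E (x ^ n • e)), by
        intro a b hab y hy
        obtain ⟨c, rfl⟩ := Nat.exists_eq_add_of_le hab
        simp only [LinearMap.mem_ker, LinearMap.toSpanSingleton_apply] at hy ⊢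
        rw [add_comm, pow_add, mul_smul, smul_comm, hy, smul_zero]⟩
    obtain ⟨a, ha⟩ := hess _ (hne n)
    have h1 : a ∈ LinearMap.ker (LinearMap.toSpanSingleton A E (x ^ (n+1) • e)) := by
      simp only [LinearMap.mem_ker, LinearMap.toSpanSingleton_apply]
      rw [pow_succ', mul_smul, smul_comm, ha, hs x hx]
    have h2 : a ∈ LinearMap.ker (LinearMap.toSpanSingleton A E (x ^ n • e)) := by
      have h3 : LinearMap.ker (LinearMap.toSpanSingleton A E (x ^ n • e)) =
        LinearMap.ker (LinearMap.toSpanSingleton A E (x ^ (n+1) • e)) := hn (n+1) (Nat.le_succ n)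
      rw [h3]; exact h1
    simp only [LinearMap.mem_ker, LinearMap.toSpanSingleton_apply] at h2
    exact hs0 (ha ▸ h2)
  refine ⟨E, inferInstance, inferInstance, hinj, ?_, ht, s, hs0, hs⟩
  obtain ⟨S, hS⟩ := (isNoetherianRing_iff_ideal_fg A).1 inferInstance (maximalIdeal A)
  have hSm : ∀ x ∈ S, x ∈ maximalIdeal A := fun x hx => hS ▸ Ideal.subset_span hx
  apply artinian_of_torsion_list S.toList
  · intro x hx; exact ht x (hSm x (by simpa using hx))
  · intro Z hZ
    have hZm : ∀ z ∈ Z, ∀ x ∈ maximalIdeal A, x • z = 0 := by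
      intro z hz x hx
      rw [← hS] at hx
      have : Ideal.span (S : Set A) ≤ LinearMap.ker (LinearMap.toSpanSingleton A E z) := by
        rw [Ideal.span_le]
        intro y hy
        simpa using hZ z hz y (by simpa using hy)
      simpa using this hx
    have hle : Z ≤ Submodule.span A {s} := by
      intro z hz
      by_cases h0 : z = 0
      · subst h0; exact zero_mem _
      obtain ⟨a, ha⟩ := hess z h0
      have : IsUnit a := by
        by_contra h
        exact hs0 (ha ▸ hZm z hz a h)
      obtain ⟨u, rfl⟩ := this
      refine Submodule.mem_span_singleton.2 ⟨(u⁻¹ : Aˣ), ?_⟩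
      rw [← ha, smul_smul]; simp
    have : IsArtinian A (A ⧸ maximalIdeal A) := by
      have : IsSimpleModule A (A ⧸ maximalIdeal A) :=
        isSimpleModule_iff_isCoatom.2 (maximalIdeal.isMaximal A).out
      infer_instance
    have h2 : IsArtinian A (Submodule.span A {s}) := by
      let t : (A ⧸ maximalIdeal A) →ₗ[A] E :=
        (maximalIdeal A).liftQ (LinearMap.toSpanSingleton A E s) (fun x hx => by simpa using hs x hx)
      have : Submodule.span A {s} ≤ LinearMap.range t := by
        rw [Submodule.span_le, Set.singleton_subset_iff]
        exact ⟨Submodule.Quotient.mk 1, by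
          change (LinearMap.toSpanSingleton A E s) 1 = s
          simp⟩
      have hr : IsArtinian A (LinearMap.range t) :=
        isArtinian_of_surjective (A ⧸ maximalIdeal A) t.rangeRestrict t.surjective_rangeRestrict
      exact isArtinian_of_le this
    exact isArtinian_of_le hle

end

section
variable {A : Type u} [CommRing A] (E : Type u) [AddCommGroup E] [Module A E]

/-- The evaluation map `E ⊗ X → Hom(X^*, E)`. -/
noncomputable def thetaMap (X : Type u) [AddCommGroup X] [Module A X] :
    E ⊗[A] X →ₗ[A] (Module.Dual A X →ₗ[A] E) :=
  TensorProduct.lift (LinearMap.mk₂ A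
    (fun e x => (LinearMap.toSpanSingleton A E e) ∘ₗ (Module.Dual.eval A X x))
    (by intros; ext; simp) (by intros; ext; simp [smul_smul, mul_comm]) (by intros; ext; simp [add_smul])
    (by intros; ext; simp [mul_smul]))

theorem thetaMap_tmul {X : Type u} [AddCommGroup X] [Module A X] (e : E) (x : X)
    (φ : Module.Dual A X) : thetaMap E X (e ⊗ₜ x) φ = φ x • e := by
  simp [thetaMap]

theorem thetaMap_nat {X Y : Type u} [AddCommGroup X] [Module A X] [AddCommGroup Y] [Module A Y]
    (f : X →ₗ[A] Y) (t : E ⊗[A] X) :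
    thetaMap E Y (f.lTensor E t) = thetaMap E X t ∘ₗ Module.Dual.transpose (R := A) f := by
  induction t using TensorProduct.induction_on with
  | zero => simp
  | tmul e x => ext φ; simp [thetaMap_tmul, Module.Dual.transpose_apply]
  | add a b ha hb => rw [map_add, map_add, ha, hb, map_add, LinearMap.add_comp]

theorem thetaMap_free_bij (n : ℕ) : Function.Bijective (thetaMap (A := A) E (ULift.{u} (Fin n) → A)) := by
  classical
  let b := Pi.basisFun A (ULift.{u} (Fin n))
  let inv : (Module.Dual A (ULift.{u} (Fin n) → A) →ₗ[A] E) →ₗ[A] E ⊗[A] (ULift.{u} (Fin n) → A) :=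
    ∑ i, (TensorProduct.mk A E _).flip (b i) ∘ₗ LinearMap.applyₗ (b.coord i)
  have hinv : ∀ ψ, inv ψ = ∑ i, ψ (b.coord i) ⊗ₜ b i := by
    intro ψ; simp [inv, LinearMap.sum_apply]
  constructor
  · apply Function.LeftInverse.injective (g := inv)
    intro t
    induction t using TensorProduct.induction_on with
    | zero => simp
    | tmul e x =>
      rw [hinv]
      simp only [thetaMap_tmul, TensorProduct.smul_tmul]
      rw [← TensorProduct.tmul_sum]
      congr 1
      exact b.sum_repr x
    | add a b ha hb => rw [map_add, map_add, ha, hb]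
  · intro ψ
    refine ⟨inv ψ, ?_⟩
    ext φ
    rw [hinv, map_sum, LinearMap.sum_apply]
    simp only [thetaMap_tmul, ← map_smul]
    rw [← map_sum]
    congr 1
    apply b.ext
    intro j
    simp [LinearMap.sum_apply, b, Pi.single_apply]

theorem exists_free_surj (X : Type u) [AddCommGroup X] [Module A X] [Module.Finite A X] :
    ∃ (n : ℕ) (p : (ULift.{u} (Fin n) → A) →ₗ[A] X), Function.Surjective p := by
  obtain ⟨n, p, hp⟩ := Module.Finite.exists_fin' A X
  exact ⟨n, p ∘ₗ (LinearEquiv.funCongrLeft A A (Equiv.ulift.{u} (α := Fin n)).symm).toLinearMap,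
    hp.comp (LinearEquiv.surjective _)⟩

theorem thetaMap_bij [IsNoetherianRing A] [hE : Module.Injective A E] (X : Type u)
    [AddCommGroup X] [Module A X] [Module.Finite A X] :
    Function.Bijective (thetaMap (A := A) E X) := by
  obtain ⟨n, p, hp⟩ := exists_free_surj (A := A) X
  have : Module.Finite A (LinearMap.ker p) := inferInstance
  obtain ⟨m, q', hq'⟩ := exists_free_surj (A := A) (LinearMap.ker p)
  let q := (LinearMap.ker p).subtype ∘ₗ q'
  have hex : Function.Exact q p := by
    intro x
    constructor
    · intro hx
      obtain ⟨y, hy⟩ := hq' ⟨x, hx⟩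
      exact ⟨y, congrArg Subtype.val hy⟩
    · rintro ⟨y, rfl⟩; exact (q' y).2
  have hpt : Function.Injective (Module.Dual.transpose (R := A) p) := by
    intro φ ψ h
    ext x
    obtain ⟨y, rfl⟩ := hp x
    exact LinearMap.congr_fun h y
  have hps : Function.Surjective (p.lTensor E) := LinearMap.lTensor_surjective E hp
  constructor
  · rw [injective_iff_map_eq_zero]
    intro t ht
    obtain ⟨t0, rfl⟩ := hps t
    rw [thetaMap_nat] at ht
    -- factor through the range of the dual of q
    let D := Module.Dual.transpose (R := A) q
    have hker : LinearMap.ker D ≤ LinearMap.ker (thetaMap E _ t0) := by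
      intro φ hφ
      have h1 : ∀ x, p x = 0 → φ x = 0 := by
        intro x hx
        obtain ⟨y, rfl⟩ := (hex x).1 hx
        exact LinearMap.congr_fun hφ y
      let φ' : Module.Dual A X := ((LinearMap.ker p).liftQ φ h1) ∘ₗ
        (p.quotKerEquivOfSurjective hp).symm.toLinearMap
      have : φ = Module.Dual.transpose (R := A) p φ' := by
        refine LinearMap.ext fun x => ?_
        have h2 : (p.quotKerEquivOfSurjective hp).symm (p x) = Submodule.Quotient.mk x := by
          rw [LinearEquiv.symm_apply_eq]; rfl
        simp only [Module.Dual.transpose_apply, LinearMap.comp_apply, φ', LinearEquiv.coe_coe]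
        rw [h2]; rfl
      rw [LinearMap.mem_ker, this]
      exact LinearMap.congr_fun ht φ'
    obtain ⟨ψ, hψ⟩ := hE.out ((LinearMap.ker D).liftQ D le_rfl)
      (LinearMap.ker_eq_bot.1 (Submodule.ker_liftQ_eq_bot _ _ _ le_rfl))
      ((LinearMap.ker D).liftQ (thetaMap E _ t0) hker)
    obtain ⟨t1, ht1⟩ := (thetaMap_free_bij (A := A) E m).2 ψ
    have : t0 = q.lTensor E t1 := by
      apply (thetaMap_free_bij (A := A) E n).1
      rw [thetaMap_nat, ht1]
      apply LinearMap.ext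
      intro φ
      exact (hψ (Submodule.Quotient.mk φ)).symm
    rw [this, ← LinearMap.comp_apply, ← LinearMap.lTensor_comp, hex.linearMap_comp_eq_zero]
    simp
  · intro ψ
    obtain ⟨ψ', hψ'⟩ := hE.out _ hpt ψ
    obtain ⟨t, ht⟩ := (thetaMap_free_bij (A := A) E n).2 ψ'
    refine ⟨p.lTensor E t, ?_⟩
    rw [thetaMap_nat, ht]
    exact LinearMap.ext hψ'

variable [IsLocalRing A] [IsNoetherianRing A] [hE : Module.Injective A E]

/-- `E` is a cogenerator for finite modules. -/
theorem cogen {s : E} (hs0 : s ≠ 0) (hs : ∀ x ∈ maximalIdeal A, x • s = 0) (X : Type u)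
    [AddCommGroup X] [Module A X] [Module.Finite A X] (h : ∀ f : X →ₗ[A] E, f = 0) :
    Subsingleton X := by
  by_contra hne
  rw [not_subsingleton_iff_nontrivial] at hne
  obtain ⟨x, hx⟩ := exists_ne (0 : X)
  -- map `A x` to `E`
  have hk : LinearMap.ker (LinearMap.toSpanSingleton A X x) ≤
      LinearMap.ker (LinearMap.toSpanSingleton A E s) := by
    intro a ha
    have : a ∈ maximalIdeal A := by
      rw [mem_maximalIdeal]
      intro hu
      obtain ⟨v, rfl⟩ := hu
      have h0 : (v : A) • x = 0 := by simpa using ha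
      apply hx
      have := congrArg (fun y => ((v⁻¹ : Aˣ) : A) • y) h0
      simpa [smul_smul] using this
    simpa using hs a this
  obtain ⟨g, hg⟩ := hE.out ((LinearMap.ker (LinearMap.toSpanSingleton A X x)).liftQ
      (LinearMap.toSpanSingleton A X x) le_rfl)
      (LinearMap.ker_eq_bot.1 (Submodule.ker_liftQ_eq_bot _ _ _ le_rfl))
      (Submodule.liftQ _ (LinearMap.toSpanSingleton A E s) hk)
  have h1 : g x = s := by
    have := hg (Submodule.Quotient.mk 1)
    have h2 : g ((LinearMap.toSpanSingleton A X x) 1) = (LinearMap.toSpanSingleton A E s) 1 := this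
    simpa using h2
  rw [h g] at h1
  exact hs0 h1.symm

theorem dual_surj_iff {s : E} (hs0 : s ≠ 0) (hs : ∀ x ∈ maximalIdeal A, x • s = 0) {X Y : Type u}
    [AddCommGroup X] [Module A X] [AddCommGroup Y] [Module A Y] [Module.Finite A X]
    [Module.Finite A Y] (f : X →ₗ[A] Y) :
    (∀ h : X →ₗ[A] A, ∃ h' : Y →ₗ[A] A, h' ∘ₗ f = h) ↔ Function.Injective (f.lTensor E) := by
  constructor
  · intro H
    rw [injective_iff_map_eq_zero]
    intro t ht
    apply (thetaMap_bij (A := A) E X).1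
    rw [map_zero]
    have := thetaMap_nat E f t
    rw [ht, map_zero] at this
    ext φ
    obtain ⟨φ', rfl⟩ := H φ
    exact (LinearMap.congr_fun this φ').symm
  · intro H
    let D : Module.Dual A Y →ₗ[A] Module.Dual A X := Module.Dual.transpose (R := A) f
    have hsub : Subsingleton (Module.Dual A X ⧸ LinearMap.range D) := by
      have : Module.Finite A (Module.Dual A X) := inferInstance
      apply cogen E hs0 hs
      intro g
      obtain ⟨t, ht⟩ := (thetaMap_bij (A := A) E X).2 (g ∘ₗ (LinearMap.range D).mkQ)
      have h0 : f.lTensor E t = 0 := by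
        apply (thetaMap_bij (A := A) E Y).1
        rw [thetaMap_nat, ht, map_zero]
        ext φ
        change g ((LinearMap.range D).mkQ (D φ)) = 0
        rw [show (LinearMap.range D).mkQ (D φ) = 0 from
          (Submodule.Quotient.mk_eq_zero _).2 ⟨φ, rfl⟩, map_zero]
      have h1 : t = 0 := H (h0.trans (map_zero _).symm)
      rw [h1, map_zero] at ht
      ext φ
      exact (LinearMap.congr_fun ht φ).symm
    intro h
    have hr := (Submodule.Quotient.subsingleton_iff).1 hsub
    have : h ∈ LinearMap.range D := by rw [hr]; trivial
    obtain ⟨h', hh⟩ := this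
    exact ⟨h', hh⟩

theorem ev_duality {s : E} (hs0 : s ≠ 0) (hs : ∀ x ∈ maximalIdeal A, x • s = 0) (n : ℕ) :
    ∀ (L : Type u) [AddCommGroup L] [Module A L] [Module.Finite A L],
    EV A L A (n+1) ↔ EV A E (CharacterModule L) (n+1) := by
  induction n with
  | zero =>
    intro L _ _ _
    obtain ⟨n, p, hp⟩ := exists_free_surj (A := A) L
    have : Module.Finite A (LinearMap.ker p) := inferInstance
    rw [ev_char_one_iff (Submodule.injective_subtype _) (ker_exact p) hp,
      ← dual_surj_iff E hs0 hs]
    exact ⟨fun h k => ev_c_lift (Submodule.injective_subtype _) (ker_exact p) hp h k,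
      fun h => ev_c_one (Submodule.injective_subtype _) (ker_exact p) hp (ev_of_proj 0) h⟩
  | succ n ih =>
    intro L _ _ _
    obtain ⟨m, p, hp⟩ := exists_free_surj (A := A) L
    have : Module.Finite A (LinearMap.ker p) := inferInstance
    rw [ev_char_succ_iff (Submodule.injective_subtype _) (ker_exact p) hp, ← ih]
    exact ⟨fun h => ev_c1 (Submodule.injective_subtype _) (ker_exact p) hp (ev_of_proj _) h,
      fun h => ev_c3 (Submodule.injective_subtype _) (ker_exact p) hp h (ev_of_proj _)⟩

end

section
variable {A : Type u} [CommRing A]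

/-- Part of the snake lemma. -/
theorem snake_ker {X₁ X₂ X₃ Y₁ Y₂ Y₃ : Type u} [AddCommGroup X₁] [Module A X₁] [AddCommGroup X₂]
    [Module A X₂] [AddCommGroup X₃] [Module A X₃] [AddCommGroup Y₁] [Module A Y₁] [AddCommGroup Y₂]
    [Module A Y₂] [AddCommGroup Y₃] [Module A Y₃]
    {f : X₁ →ₗ[A] X₂} {g : X₂ →ₗ[A] X₃} {f' : Y₁ →ₗ[A] Y₂} {g' : Y₂ →ₗ[A] Y₃}
    {a₁ : X₁ →ₗ[A] Y₁} {a₂ : X₂ →ₗ[A] Y₂} {a₃ : X₃ →ₗ[A] Y₃}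
    (hf : Function.Injective f) (he : Function.Exact f g) (hg : Function.Surjective g)
    (hf' : Function.Injective f') (he' : Function.Exact f' g')
    (h12 : ∀ x, a₂ (f x) = f' (a₁ x)) (h23 : ∀ x, a₃ (g x) = g' (a₂ x))
    (hs : Function.Surjective a₁) :
    ∃ (u : LinearMap.ker a₁ →ₗ[A] LinearMap.ker a₂) (v : LinearMap.ker a₂ →ₗ[A] LinearMap.ker a₃),
      Function.Injective u ∧ Function.Exact u v ∧ Function.Surjective v := by
  refine ⟨f.restrict (p := LinearMap.ker a₁) (q := LinearMap.ker a₂) (fun x hx => by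
      rw [LinearMap.mem_ker] at hx ⊢; rw [h12, hx, map_zero]),
    g.restrict (p := LinearMap.ker a₂) (q := LinearMap.ker a₃) (fun x hx => by
      rw [LinearMap.mem_ker] at hx ⊢; rw [h23, hx, map_zero]), ?_, ?_, ?_⟩
  · intro x y h
    exact Subtype.ext (hf (congrArg Subtype.val h))
  · rintro ⟨x, hx⟩
    constructor
    · intro h
      have h' : g x = 0 := congrArg Subtype.val h
      obtain ⟨y, rfl⟩ := (he x).1 h'
      refine ⟨⟨y, ?_⟩, rfl⟩
      rw [LinearMap.mem_ker]
      apply hf'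
      rw [← h12, map_zero]; exact hx
    · rintro ⟨⟨y, hy⟩, h⟩
      have h' : f y = x := congrArg Subtype.val h
      apply Subtype.ext
      change g x = 0
      rw [← h', he.apply_apply_eq_zero]
  · rintro ⟨z, hz⟩
    obtain ⟨x, rfl⟩ := hg z
    have h0 : g' (a₂ x) = 0 := by rw [← h23]; exact hz
    obtain ⟨y, hy⟩ := (he' _).1 h0
    obtain ⟨w, rfl⟩ := hs y
    refine ⟨⟨x - f w, ?_⟩, ?_⟩
    · rw [LinearMap.mem_ker, map_sub, h12, hy, sub_self]
    · apply Subtype.ext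
      change g (x - f w) = g x
      rw [map_sub, he.apply_apply_eq_zero, sub_zero]

theorem ker_projective {X P : Type u} [AddCommGroup X] [Module A X] [AddCommGroup P] [Module A P]
    [Module.Projective A X] [Module.Projective A P] (f : X →ₗ[A] P) (hf : Function.Surjective f) :
    Module.Projective A (LinearMap.ker f) := by
  obtain ⟨s, hs⟩ := Module.projective_lifting_property f LinearMap.id hf
  have hs' : ∀ p, f (s p) = p := fun p => LinearMap.congr_fun hs p
  refine Module.Projective.of_split (LinearMap.ker f).subtype
    ((LinearMap.id - s ∘ₗ f).codRestrict (LinearMap.ker f) (fun x => ?_)) ?_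
  · ext x
    simp
  · rw [LinearMap.mem_ker]
    simp [hs']

variable (A) in
/-- Modules built from a class `S` by extensions and syzygies. -/
inductive Cl (S : ∀ (B : Type u) [AddCommGroup B] [Module A B], Prop) :
    ∀ (B : Type u) [AddCommGroup B] [Module A B], Prop
  | base (B : Type u) [AddCommGroup B] [Module A B] : S B → Cl S B
  | ext (C₁ C₂ C₃ : Type u) [AddCommGroup C₁] [Module A C₁] [AddCommGroup C₂] [Module A C₂]
      [AddCommGroup C₃] [Module A C₃] (f : C₁ →ₗ[A] C₂) (g : C₂ →ₗ[A] C₃)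
      (hf : Function.Injective f) (he : Function.Exact f g) (hg : Function.Surjective g) :
      Cl S C₁ → Cl S C₃ → Cl S C₂
  | syz (C₁ C₂ C₃ : Type u) [AddCommGroup C₁] [Module A C₁] [AddCommGroup C₂] [Module A C₂]
      [AddCommGroup C₃] [Module A C₃] (f : C₁ →ₗ[A] C₂) (g : C₂ →ₗ[A] C₃)
      (hf : Function.Injective f) (he : Function.Exact f g) (hg : Function.Surjective g)
      (hp : Module.Projective A C₂) :
      Cl S C₃ → Cl S C₁

/-- the mapping `C × P → C`, `(c, p) ↦ x c + π p`. -/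
noncomputable def xmap (x : A) {C P : Type u} [AddCommGroup C] [Module A C] [AddCommGroup P] [Module A P]
    (π : P →ₗ[A] C) : C × P →ₗ[A] C := (LinearMap.lsmul A C x).coprod π

theorem xmap_apply (x : A) {C P : Type u} [AddCommGroup C] [Module A C] [AddCommGroup P]
    [Module A P] (π : P →ₗ[A] C) (z : C × P) : xmap x π z = x • z.1 + π z.2 := by
  simp [xmap]

theorem xmap_surj (x : A) {C P : Type u} [AddCommGroup C] [Module A C] [AddCommGroup P]
    [Module A P] (π : P →ₗ[A] C) (h : Function.Surjective π) : Function.Surjective (xmap x π) := by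
  intro c
  obtain ⟨p, rfl⟩ := h c
  exact ⟨(0, p), by simp [xmap_apply]⟩

/-- Horseshoe. -/
theorem horseshoe {C₁ C₂ C₃ P₁ P₃ : Type u} [AddCommGroup C₁] [Module A C₁] [AddCommGroup C₂]
    [Module A C₂] [AddCommGroup C₃] [Module A C₃] [AddCommGroup P₁] [Module A P₁]
    [AddCommGroup P₃] [Module A P₃] [Module.Projective A P₃] {f : C₁ →ₗ[A] C₂} {g : C₂ →ₗ[A] C₃}
    (he : Function.Exact f g) (hg : Function.Surjective g)
    (π₁ : P₁ →ₗ[A] C₁) (h₁ : Function.Surjective π₁)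
    (π₃ : P₃ →ₗ[A] C₃) (h₃ : Function.Surjective π₃) :
    ∃ π₂ : P₁ × P₃ →ₗ[A] C₂, Function.Surjective π₂ ∧ (∀ p, π₂ (p, 0) = f (π₁ p)) ∧
      ∀ z, g (π₂ z) = π₃ z.2 := by
  obtain ⟨s, hs⟩ := Module.projective_lifting_property g π₃ hg
  have hs' : ∀ p, g (s p) = π₃ p := fun p => LinearMap.congr_fun hs p
  refine ⟨(f ∘ₗ π₁).coprod s, ?_, ?_, ?_⟩
  · intro c
    obtain ⟨p₃, hp₃⟩ := h₃ (g c)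
    have : g (c - s p₃) = 0 := by rw [map_sub, hs', hp₃, sub_self]
    obtain ⟨c₁, hc₁⟩ := (he _).1 this
    obtain ⟨p₁, rfl⟩ := h₁ c₁
    exact ⟨(p₁, p₃), by simp [hc₁]⟩
  · intro p; simp
  · intro z; simp [hs', he.apply_apply_eq_zero]

theorem prod_exact {C₁ C₂ C₃ : Type u} [AddCommGroup C₁] [Module A C₁] [AddCommGroup C₂]
    [Module A C₂] [AddCommGroup C₃] [Module A C₃] (P₁ P₃ : Type u) [AddCommGroup P₁] [Module A P₁]
    [AddCommGroup P₃] [Module A P₃] {f : C₁ →ₗ[A] C₂} {g : C₂ →ₗ[A] C₃}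
    (hf : Function.Injective f) (he : Function.Exact f g) (hg : Function.Surjective g) :
    Function.Injective (f.prodMap (LinearMap.inl A P₁ P₃)) ∧
    Function.Exact (f.prodMap (LinearMap.inl A P₁ P₃)) (g.prodMap (LinearMap.snd A P₁ P₃)) ∧
    Function.Surjective (g.prodMap (LinearMap.snd A P₁ P₃)) := by
  refine ⟨?_, ?_, ?_⟩
  · rintro ⟨a, b⟩ ⟨c, d⟩ h
    simp only [LinearMap.prodMap_apply, Prod.mk.injEq, LinearMap.inl_apply, and_true] at h
    exact Prod.ext (hf h.1) h.2
  · rintro ⟨c, p, q⟩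
    constructor
    · intro h
      simp only [LinearMap.prodMap_apply, LinearMap.snd_apply, Prod.mk_eq_zero] at h
      obtain ⟨c₁, rfl⟩ := (he c).1 h.1
      exact ⟨(c₁, p), by simp [h.2]⟩
    · rintro ⟨⟨a, b⟩, h⟩
      rw [← h]
      simp [he.apply_apply_eq_zero]
  · rintro ⟨c, q⟩
    obtain ⟨c, rfl⟩ := hg c
    exact ⟨(c, 0, q), rfl⟩

theorem inl_snd_exact (P₁ P₃ : Type u) [AddCommGroup P₁] [Module A P₁]
    [AddCommGroup P₃] [Module A P₃] : Function.Injective (LinearMap.inl A P₁ P₃) ∧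
    Function.Exact (LinearMap.inl A P₁ P₃) (LinearMap.snd A P₁ P₃) ∧
    Function.Surjective (LinearMap.snd A P₁ P₃) :=
  ⟨LinearMap.inl_injective, fun z => by
    constructor
    · intro h; exact ⟨z.1, Prod.ext rfl h.symm⟩
    · rintro ⟨y, rfl⟩; rfl, LinearMap.snd_surjective⟩

/-- the step from `C` to the cone of multiplication by `x`. -/
theorem cl_step (x : A) {S S' : ∀ (B : Type u) [AddCommGroup B] [Module A B], Prop}
    (hS : ∀ (B : Type u) [AddCommGroup B] [Module A B], S B →
      S' (LinearMap.ker (LinearMap.lsmul A B x)) ∧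
      S' (B ⧸ LinearMap.range (LinearMap.lsmul A B x)))
    (C : Type u) [AddCommGroup C] [Module A C] (h : Cl A S C) :
    ∃ (P : Type u) (_ : AddCommGroup P) (_ : Module A P) (π : P →ₗ[A] C),
      Module.Projective A P ∧ Function.Surjective π ∧ Cl A S' (LinearMap.ker (xmap x π)) := by
  induction h with
  | base B hB =>
    have hs : Function.Surjective (Finsupp.linearCombination A (id : B → B)) :=
      Finsupp.linearCombination_surjective A Function.surjective_id
    set π := Finsupp.linearCombination A (id : B → B)
    refine ⟨B →₀ A, inferInstance, inferInstance, π, inferInstance, hs, ?_⟩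
    set xB := LinearMap.lsmul A B x with hxB
    let ρ : (B →₀ A) →ₗ[A] B ⧸ LinearMap.range xB := (LinearMap.range xB).mkQ ∘ₗ π
    have hρ : Function.Surjective ρ := (Submodule.mkQ_surjective _).comp hs
    have hρ0 : ∀ p, ρ p = 0 ↔ ∃ b, x • b = π p := by
      intro p
      change (LinearMap.range xB).mkQ (π p) = 0 ↔ _
      rw [Submodule.mkQ_apply, Submodule.Quotient.mk_eq_zero]
      exact Iff.rfl
    refine Cl.ext (LinearMap.ker xB) _ (LinearMap.ker ρ)
      ((LinearMap.inl A B (B →₀ A)).restrict (fun b hb => ?_))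
      ((LinearMap.snd A B (B →₀ A)).restrict (fun z hz => ?_)) ?_ ?_ ?_
      (Cl.base _ (hS B hB).1)
      (Cl.syz _ _ _ _ ρ (Submodule.injective_subtype _) (ker_exact ρ) hρ inferInstance
        (Cl.base _ (hS B hB).2))
    · have hb' : x • b = 0 := hb
      rw [LinearMap.mem_ker, xmap_apply]
      simp [hb']
    · rw [LinearMap.mem_ker, xmap_apply] at hz
      rw [LinearMap.mem_ker, hρ0]
      exact ⟨- z.1, by rw [smul_neg]; exact neg_eq_of_add_eq_zero_right hz⟩
    · intro a b h
      exact Subtype.ext (congrArg Prod.fst (congrArg Subtype.val h))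
    · rintro ⟨⟨b, p⟩, hz⟩
      rw [LinearMap.mem_ker, xmap_apply] at hz
      constructor
      · intro h
        have hp : p = 0 := congrArg Subtype.val h
        subst hp
        refine ⟨⟨b, ?_⟩, rfl⟩
        simpa [hxB] using hz
      · rintro ⟨b', h⟩
        have h' : (0 : B →₀ A) = p := congrArg Prod.snd (congrArg Subtype.val h)
        exact Subtype.ext h'.symm
    · rintro ⟨p, hp⟩
      obtain ⟨b, hb⟩ := (hρ0 p).1 hp
      refine ⟨⟨(-b, p), ?_⟩, rfl⟩
      rw [LinearMap.mem_ker, xmap_apply]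
      simp [hb]
  | ext C₁ C₂ C₃ f g hf he hg _ _ ih₁ ih₃ =>
    obtain ⟨P₁, _, _, π₁, hP₁, hπ₁, hc₁⟩ := ih₁
    obtain ⟨P₃, _, _, π₃, hP₃, hπ₃, hc₃⟩ := ih₃
    obtain ⟨π₂, hπ₂, h12, h23⟩ := horseshoe he hg π₁ hπ₁ π₃ hπ₃
    refine ⟨P₁ × P₃, inferInstance, inferInstance, π₂, inferInstance, hπ₂, ?_⟩
    obtain ⟨k1, k2, k3⟩ := prod_exact P₁ P₃ hf he hg
    obtain ⟨u, v, hu, huv, hv⟩ := snake_ker (a₁ := xmap x π₁) (a₂ := xmap x π₂)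
      (a₃ := xmap x π₃) k1 k2 k3 hf he
      (by intro z; simp [xmap_apply, h12])
      (by intro z; simp [xmap_apply, h23]) (xmap_surj x π₁ hπ₁)
    exact Cl.ext _ _ _ u v hu huv hv hc₁ hc₃
  | syz C₁ C₂ C₃ f g hf he hg hp _ ih₃ =>
    obtain ⟨P₃, _, _, π₃, hP₃, hπ₃, hc₃⟩ := ih₃
    have hπ₁ : Function.Surjective (Finsupp.linearCombination A (id : C₁ → C₁)) :=
      Finsupp.linearCombination_surjective A Function.surjective_id
    set π₁ := Finsupp.linearCombination A (id : C₁ → C₁)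
    obtain ⟨π₂, hπ₂, h12, h23⟩ := horseshoe he hg π₁ hπ₁ π₃ hπ₃
    refine ⟨C₁ →₀ A, inferInstance, inferInstance, π₁, inferInstance, hπ₁, ?_⟩
    obtain ⟨k1, k2, k3⟩ := prod_exact (C₁ →₀ A) P₃ hf he hg
    obtain ⟨u, v, hu, huv, hv⟩ := snake_ker (a₁ := xmap x π₁) (a₂ := xmap x π₂)
      (a₃ := xmap x π₃) k1 k2 k3 hf he
      (by intro z; simp [xmap_apply, h12])
      (by intro z; simp [xmap_apply, h23]) (xmap_surj x π₁ hπ₁)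
    exact Cl.syz _ _ _ u v hu huv hv (ker_projective _ (xmap_surj x π₂ hπ₂)) hc₃

/-- `C` has an `n`-th syzygy which is finitely generated. -/
def FGn (A : Type u) [CommRing A] : ℕ → ∀ (C : Type u) [AddCommGroup C] [Module A C], Prop
  | 0 => fun C _ _ => Module.Finite A C
  | n + 1 => fun C _ _ => ∃ (P : Type u) (_ : AddCommGroup P) (_ : Module A P) (π : P →ₗ[A] C),
      Module.Projective A P ∧ Function.Surjective π ∧ FGn A n (LinearMap.ker π)

theorem fgn_ext (n : ℕ) : ∀ (C₁ C₂ C₃ : Type u) [AddCommGroup C₁] [Module A C₁] [AddCommGroup C₂]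
    [Module A C₂] [AddCommGroup C₃] [Module A C₃] (f : C₁ →ₗ[A] C₂) (g : C₂ →ₗ[A] C₃)
    (_ : Function.Injective f) (_ : Function.Exact f g) (_ : Function.Surjective g),
    FGn A n C₁ → FGn A n C₃ → FGn A n C₂ := by
  induction n with
  | zero =>
    intro C₁ C₂ C₃ _ _ _ _ _ _ f g hf he hg h1 h3
    have : Module.Finite A C₁ := h1
    have : Module.Finite A C₃ := h3
    exact Module.Finite.of_exact he hg
  | succ n ih =>
    intro C₁ C₂ C₃ _ _ _ _ _ _ f g hf he hg h1 h3
    obtain ⟨P₁, _, _, π₁, hP₁, hπ₁, hc₁⟩ := h1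
    obtain ⟨P₃, _, _, π₃, hP₃, hπ₃, hc₃⟩ := h3
    obtain ⟨π₂, hπ₂, h12, h23⟩ := horseshoe he hg π₁ hπ₁ π₃ hπ₃
    refine ⟨P₁ × P₃, inferInstance, inferInstance, π₂, inferInstance, hπ₂, ?_⟩
    obtain ⟨k1, k2, k3⟩ := inl_snd_exact (A := A) P₁ P₃
    obtain ⟨u, v, hu, huv, hv⟩ := snake_ker (a₁ := π₁) (a₂ := π₂)
      (a₃ := π₃) k1 k2 k3 hf he
      (by intro z; simp [h12])
      (by intro z; simp [h23]) hπ₁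
    exact ih _ _ _ u v hu huv hv hc₁ hc₃

theorem fgn_succ [IsNoetherianRing A] (n : ℕ) : ∀ (C : Type u) [AddCommGroup C] [Module A C],
    FGn A n C → FGn A (n+1) C := by
  induction n with
  | zero =>
    intro C _ _ h
    have : Module.Finite A C := h
    obtain ⟨k, p, hp⟩ := exists_free_surj (A := A) C
    refine ⟨_, inferInstance, inferInstance, p, inferInstance, hp, ?_⟩
    exact (inferInstance : Module.Finite A (LinearMap.ker p))
  | succ n ih =>
    intro C _ _ h
    obtain ⟨P, _, _, π, hP, hπ, hc⟩ := h
    exact ⟨P, _, _, π, hP, hπ, ih _ hc⟩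

theorem fgn_mono [IsNoetherianRing A] {n m : ℕ} (hnm : n ≤ m) (C : Type u) [AddCommGroup C]
    [Module A C] (h : FGn A n C) : FGn A m C := by
  induction hnm with
  | refl => exact h
  | step _ ih => exact fgn_succ _ C ih

theorem fgn_finite [IsNoetherianRing A] (n : ℕ) (C : Type u) [AddCommGroup C]
    [Module A C] [h : Module.Finite A C] : FGn A n C :=
  fgn_mono (Nat.zero_le n) C h

theorem fgn_congr [IsNoetherianRing A] (n : ℕ) {C D : Type u} [AddCommGroup C]
    [Module A C] [AddCommGroup D] [Module A D] (e : C ≃ₗ[A] D) (h : FGn A n C) : FGn A n D := by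
  refine fgn_ext n C D PUnit.{u+1} e.toLinearMap 0 e.injective ?_ ?_ h (fgn_finite n _)
  · intro x; simp
  · intro x; exact ⟨0, Subsingleton.elim _ _⟩

theorem fgn_proj [IsNoetherianRing A] (n : ℕ) (P : Type u) [AddCommGroup P]
    [Module A P] [Module.Projective A P] : FGn A (n+1) P := by
  refine ⟨P, inferInstance, inferInstance, LinearMap.id, inferInstance, Function.surjective_id, ?_⟩
  have : Module.Finite A (LinearMap.ker (LinearMap.id : P →ₗ[A] P)) := by
    rw [LinearMap.ker_id]; infer_instance
  exact fgn_finite n _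

theorem fgn_of_ext_proj [IsNoetherianRing A] (n : ℕ) {K D P : Type u} [AddCommGroup K]
    [Module A K] [AddCommGroup D] [Module A D] [AddCommGroup P] [Module A P]
    [Module.Projective A P] (a : K →ₗ[A] D) (b : D →ₗ[A] P) (ha : Function.Injective a)
    (hab : Function.Exact a b) (hb : Function.Surjective b) (h : FGn A (n+1) D) :
    FGn A (n+1) K := by
  obtain ⟨Q, _, _, q, hQ, hq, hL⟩ := h
  have hp : Module.Projective A (LinearMap.ker (b ∘ₗ q)) := ker_projective _ (hb.comp hq)
  let e := LinearEquiv.ofInjective a ha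
  let t : LinearMap.ker (b ∘ₗ q) →ₗ[A] K := e.symm.toLinearMap ∘ₗ
    (q ∘ₗ (LinearMap.ker (b ∘ₗ q)).subtype).codRestrict (LinearMap.range a)
      (fun z => (hab _).1 z.2)
  have ht : ∀ z, a (t z) = q z := by
    intro z
    have : ((e (t z) : LinearMap.range a) : D) = q z := by
      simp [t]
      rfl
    rw [← this]; rfl
  refine ⟨_, inferInstance, inferInstance, t, hp, ?_, ?_⟩
  · intro k
    obtain ⟨z, hz⟩ := hq (a k)
    refine ⟨⟨z, ?_⟩, ?_⟩
    · rw [LinearMap.mem_ker, LinearMap.comp_apply, hz, hab.apply_apply_eq_zero]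
    · apply ha; rw [ht]; exact hz
  · have hz : ∀ z : LinearMap.ker q, (z : Q) ∈ LinearMap.ker (b ∘ₗ q) := by
      intro z
      rw [LinearMap.mem_ker, LinearMap.comp_apply, z.2, map_zero]
    refine fgn_congr n (LinearEquiv.ofBijective (LinearMap.codRestrict (LinearMap.ker t)
      ((LinearMap.ker q).subtype.codRestrict (LinearMap.ker (b ∘ₗ q)) hz) ?_) ⟨?_, ?_⟩) hL
    · intro z
      rw [LinearMap.mem_ker]
      apply ha
      rw [ht, map_zero]; exact z.2
    · intro z w hzw
      have h1 := congrArg Subtype.val hzw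
      have h2 : (z : Q) = (w : Q) := congrArg (fun v => (v.1 : Q)) h1
      exact Subtype.ext h2
    · rintro ⟨⟨z, h1⟩, h2⟩
      have h3 : q z = 0 := by
        rw [← ht ⟨z, h1⟩, h2, map_zero]
      exact ⟨⟨z, h3⟩, rfl⟩

theorem fgn_syz [IsNoetherianRing A] (n : ℕ) {K P C : Type u} [AddCommGroup K]
    [Module A K] [AddCommGroup P] [Module A P] [AddCommGroup C] [Module A C]
    [Module.Projective A P] (f : K →ₗ[A] P) (g : P →ₗ[A] C) (hf : Function.Injective f)
    (he : Function.Exact f g) (hg : Function.Surjective g) (h : FGn A n C) :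
    FGn A (n+1) K := by
  obtain ⟨P', _, _, π, hP', hπ, hK'⟩ := fgn_succ n C h
  let D := LinearMap.ker (g.coprod (-π))
  have hD : ∀ z : P × P', z ∈ D ↔ g z.1 = π z.2 := by
    intro z
    rw [LinearMap.mem_ker, LinearMap.coprod_apply, LinearMap.neg_apply, ← sub_eq_add_neg,
      sub_eq_zero]
  have hDf : FGn A (n+1) D := by
    refine fgn_ext (n+1) (LinearMap.ker π) D P
      (((LinearMap.inr A P P') ∘ₗ (LinearMap.ker π).subtype).codRestrict D (fun z => ?_))
      (LinearMap.fst A P P' ∘ₗ D.subtype) ?_ ?_ ?_ (fgn_succ n _ hK') (fgn_proj n P)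
    · rw [hD]
      change g 0 = π z
      rw [z.2, map_zero]
    · intro z w h
      exact Subtype.ext (congrArg Prod.snd (congrArg Subtype.val h))
    · rintro ⟨⟨p, p'⟩, hz⟩
      constructor
      · intro h
        have hp : p = 0 := h
        subst hp
        have := (hD _).1 hz
        exact ⟨⟨p', by rw [LinearMap.mem_ker, ← this]; exact map_zero g⟩, rfl⟩
      · rintro ⟨w, h⟩
        exact (congrArg Prod.fst (congrArg Subtype.val h)).symm
    · intro p
      obtain ⟨p', hp'⟩ := hπ (g p)
      exact ⟨⟨(p, p'), (hD _).2 hp'.symm⟩, rfl⟩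
  refine fgn_of_ext_proj n (D := D) (P := P')
    (((LinearMap.inl A P P') ∘ₗ f).codRestrict D (fun z => ?_))
      (LinearMap.snd A P P' ∘ₗ D.subtype) ?_ ?_ ?_ hDf
  · rw [hD]
    change g (f z) = π 0
    rw [he.apply_apply_eq_zero, map_zero]
  · intro z w h
    exact hf (congrArg Prod.fst (congrArg Subtype.val h))
  · rintro ⟨⟨p, p'⟩, hz⟩
    constructor
    · intro h
      have hp : p' = 0 := h
      subst hp
      have h1 := (hD _).1 hz
      have h2 : g p = 0 := h1.trans (map_zero π)
      obtain ⟨k, rfl⟩ := (he p).1 h2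
      exact ⟨k, rfl⟩
    · rintro ⟨w, h⟩
      exact (congrArg Prod.snd (congrArg Subtype.val h)).symm
  · intro p'
    obtain ⟨p, hp⟩ := hg (π p')
    exact ⟨⟨(p, p'), (hD _).2 hp⟩, rfl⟩

theorem fgn_of_cl [IsNoetherianRing A] {S : ∀ (B : Type u) [AddCommGroup B] [Module A B], Prop}
    (hS : ∀ (B : Type u) [AddCommGroup B] [Module A B], S B → Module.Finite A B)
    (C : Type u) [AddCommGroup C] [Module A C] (h : Cl A S C) : ∃ n, FGn A n C := by
  induction h with
  | base B hB => exact ⟨0, hS B hB⟩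
  | ext C₁ C₂ C₃ f g hf he hg _ _ ih₁ ih₃ =>
    obtain ⟨n, hn⟩ := ih₁
    obtain ⟨m, hm⟩ := ih₃
    exact ⟨max n m, fgn_ext _ _ _ _ f g hf he hg (fgn_mono (le_max_left _ _) _ hn)
      (fgn_mono (le_max_right _ _) _ hm)⟩
  | syz C₁ C₂ C₃ f g hf he hg hp _ ih₃ =>
    obtain ⟨m, hm⟩ := ih₃
    exact ⟨m+1, fgn_syz m f g hf he hg hm⟩

/-- eventual vanishing of Ext -/
def VV (A : Type u) [CommRing A] (C T : Type u) [AddCommGroup C] [Module A C] [AddCommGroup T]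
    [Module A T] : Prop := ∃ n, ∀ i, n < i → EV A C T i

theorem vv_of_fgn (n : ℕ) : ∀ (C : Type u) [AddCommGroup C] [Module A C], FGn A n C →
    ∃ (N : Type u) (_ : AddCommGroup N) (_ : Module A N), Module.Finite A N ∧
      ∀ (T : Type u) [AddCommGroup T] [Module A T], VV A C T ↔ VV A N T := by
  induction n with
  | zero =>
    intro C _ _ h
    exact ⟨C, inferInstance, inferInstance, h, fun T _ _ => Iff.rfl⟩
  | succ n ih =>
    intro C _ _ h
    obtain ⟨P, _, _, π, hP, hπ, hK⟩ := h
    obtain ⟨N, _, _, hN, hNT⟩ := ih _ hK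
    refine ⟨N, _, _, hN, fun T _ _ => Iff.trans ?_ (hNT T)⟩
    constructor
    · rintro ⟨m, hm⟩
      refine ⟨m, fun i hi => ?_⟩
      obtain ⟨p, rfl⟩ : ∃ p, i = p + 1 := ⟨i - 1, by omega⟩
      exact ev_c1 (Submodule.injective_subtype _) (ker_exact π) hπ (ev_of_proj p)
        (hm _ (by omega))
    · rintro ⟨m, hm⟩
      refine ⟨m+1, fun i hi => ?_⟩
      obtain ⟨p, rfl⟩ : ∃ p, i = p + 1 := ⟨i - 1, by omega⟩
      exact ev_c3 (Submodule.injective_subtype _) (ker_exact π) hπ (hm p (by omega))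
        (ev_of_proj p)

section
variable {C P T : Type u} [AddCommGroup C] [Module A C] [AddCommGroup P] [Module A P]
    [Module.Projective A P] [AddCommGroup T] [Module A T]

theorem vv_xmap (x : A) (π : P →ₗ[A] C) (hπ : Function.Surjective π) (h : VV A C T) :
    VV A (LinearMap.ker (xmap x π)) T := by
  obtain ⟨n, hn⟩ := h
  refine ⟨n, fun i hi => ?_⟩
  obtain ⟨p, rfl⟩ : ∃ p, i = p + 1 := ⟨i - 1, by omega⟩
  obtain ⟨k1, k2, k3⟩ := inl_snd_exact (A := A) C P
  exact ev_c1 (Submodule.injective_subtype _) (ker_exact _) (xmap_surj x π hπ)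
    (ev_c2 k1 k2 k3 (hn _ hi) (ev_of_proj p)) (hn _ (by omega))

theorem vv_of_xmap (x : A) (hx : ∀ t : T, x • t = 0) (π : P →ₗ[A] C)
    (hπ : Function.Surjective π) (h : VV A (LinearMap.ker (xmap x π)) T) : VV A C T := by
  obtain ⟨n, hn⟩ := h
  refine ⟨n+1, fun i hi e => ?_⟩
  obtain ⟨p, rfl⟩ : ∃ p, i = p + 1 := ⟨i - 1, by omega⟩
  obtain ⟨k1, k2, k3⟩ := inl_snd_exact (A := A) C P
  have hxe : x • e = 0 := by
    rw [Abelian.Ext.smul_eq_comp_mk₀]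
    have : x • 𝟙 (ModuleCat.of A T) = 0 := by
      ext t
      exact hx t
    rw [this]; simp
  have h0 : (Abelian.Ext.mk₀ (ModuleCat.ofHom (xmap x π))).comp e (zero_add (p+1)) = 0 := by
    obtain ⟨y, hy⟩ := Abelian.Ext.contravariant_sequence_exact₂ (ses_mod k1 k2 k3)
      (ModuleCat.of A T) ((Abelian.Ext.mk₀ (ModuleCat.ofHom (xmap x π))).comp e (zero_add (p+1)))
      (by
        change (Abelian.Ext.mk₀ (ModuleCat.ofHom (LinearMap.inl A C P))).comp _ _ = 0
        rw [Abelian.Ext.mk₀_comp_mk₀_assoc]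
        have : ModuleCat.ofHom (LinearMap.inl A C P) ≫ ModuleCat.ofHom (xmap x π) =
            x • 𝟙 (ModuleCat.of A C) := by
          ext c
          change xmap x π (c, 0) = x • c
          simp [xmap_apply]
        rw [this, Abelian.Ext.mk₀_smul, Abelian.Ext.smul_comp]
        simpa using hxe)
    rw [← hy, show y = 0 from (ev_of_proj p : EV A P T (p+1)) y]
    simp
  obtain ⟨y, hy⟩ := Abelian.Ext.contravariant_sequence_exact₃
    (ses_mod (Submodule.injective_subtype _) (ker_exact _) (xmap_surj x π hπ))
    (ModuleCat.of A T) e h0 (add_comm 1 p)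
  rw [← hy, show y = 0 from hn p (by omega) y]
  simp

end

/-- artinian modules killed by the elements of a list -/
def SArt (A : Type u) [CommRing A] (l : List A) (B : Type u) [AddCommGroup B] [Module A B] : Prop :=
  IsArtinian A B ∧ ∀ x ∈ l, ∀ b : B, x • b = 0

theorem sart_step (x : A) (l : List A) (B : Type u) [AddCommGroup B] [Module A B]
    (h : SArt A l B) : SArt A (x :: l) (LinearMap.ker (LinearMap.lsmul A B x)) ∧
      SArt A (x :: l) (B ⧸ LinearMap.range (LinearMap.lsmul A B x)) := by
  obtain ⟨h1, h2⟩ := h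
  refine ⟨⟨inferInstance, ?_⟩, ⟨inferInstance, ?_⟩⟩
  · intro y hy b
    rcases List.mem_cons.1 hy with rfl | hy
    · exact Subtype.ext b.2
    · exact Subtype.ext (h2 y hy b)
  · intro y hy b
    obtain ⟨b, rfl⟩ := Submodule.Quotient.mk_surjective _ b
    rw [← Submodule.Quotient.mk_smul, Submodule.Quotient.mk_eq_zero]
    rcases List.mem_cons.1 hy with rfl | hy
    · exact ⟨b, rfl⟩
    · rw [h2 y hy b]; exact zero_mem _

/-- Iterating over a list of elements. -/
theorem koszul (l : List A) (l₀ : List A) : ∀ (C : Type u) [AddCommGroup C] [Module A C],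
    Cl A (fun B _ _ => SArt A l₀ B) C →
    ∃ (l' : List A) (C' : Type u) (_ : AddCommGroup C') (_ : Module A C'), (∀ x ∈ l, x ∈ l') ∧
      Cl A (fun B _ _ => SArt A l' B) C' ∧
      (∀ (T : Type u) [AddCommGroup T] [Module A T], VV A C T → VV A C' T) ∧
      (∀ (T : Type u) [AddCommGroup T] [Module A T], (∀ x ∈ l, ∀ t : T, x • t = 0) →
        VV A C' T → VV A C T) := by
  induction l with
  | nil =>
    intro C _ _ h
    exact ⟨l₀, C, _, _, by simp, h, fun T _ _ h => h, fun T _ _ _ h => h⟩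
  | cons x l ih =>
    intro C _ _ h
    obtain ⟨l', C', _, _, hl, hC, h1, h2⟩ := ih C h
    obtain ⟨P, _, _, π, hP, hπ, hc⟩ := cl_step x
      (S' := fun B _ _ => SArt A (x :: l') B) (fun B _ _ hB => sart_step x l' B hB) C' hC
    refine ⟨x :: l', _, _, _, ?_, hc, ?_, ?_⟩
    · intro y hy
      rcases List.mem_cons.1 hy with rfl | hy
      · simp
      · simp [hl y hy]
    · intro T _ _ hT
      exact vv_xmap x π hπ (h1 T hT)
    · intro T _ _ hk hT
      exact h2 T (fun y hy => hk y (by simp [hy])) (vv_of_xmap x (hk x (by simp)) π hπ hT)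

theorem finite_of_art_field (k B : Type u) [Field k] [AddCommGroup B] [Module k B]
    [IsArtinian k B] : Module.Finite k B := by
  have h := IsArtinian.finite_of_linearIndependent
    (Module.Basis.ofVectorSpaceIndex.linearIndependent k B)
  haveI : Finite (Module.Basis.ofVectorSpaceIndex k B) := h
  exact Module.Finite.of_basis (Module.Basis.ofVectorSpace k B)

theorem finite_of_killed [IsLocalRing A] (B : Type u) [AddCommGroup B] [Module A B]
    [IsArtinian A B] (h : ∀ x ∈ maximalIdeal A, ∀ b : B, x • b = 0) : Module.Finite A B := by
  have ht : Module.IsTorsionBySet A B (maximalIdeal A : Set A) := fun b x => h x x.2 b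
  letI : Module (A ⧸ maximalIdeal A) B := ht.module
  letI : Field (A ⧸ maximalIdeal A) := Ideal.Quotient.field _
  haveI : IsScalarTower A (A ⧸ maximalIdeal A) B := ht.isScalarTower
  have : IsArtinian (A ⧸ maximalIdeal A) B := isArtinian_of_tower A inferInstance
  have : Module.Finite (A ⧸ maximalIdeal A) B := finite_of_art_field _ _
  exact Module.Finite.trans (A ⧸ maximalIdeal A) B

theorem exists_fg_model [IsLocalRing A] [IsNoetherianRing A] (E : Type u) [AddCommGroup E]
    [Module A E] [IsArtinian A E] : ∃ (N : Type u) (_ : AddCommGroup N) (_ : Module A N),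
      Module.Finite A N ∧
      (∀ (T : Type u) [AddCommGroup T] [Module A T], VV A E T → VV A N T) ∧
      (∀ (T : Type u) [AddCommGroup T] [Module A T], (∀ x ∈ maximalIdeal A, ∀ t : T, x • t = 0) →
        VV A N T → VV A E T) := by
  obtain ⟨S, hS⟩ := (isNoetherianRing_iff_ideal_fg A).1 inferInstance (maximalIdeal A)
  have hSm : ∀ x ∈ S, x ∈ maximalIdeal A := fun x hx => hS ▸ Ideal.subset_span hx
  obtain ⟨l', C, _, _, hl, hC, h1, h2⟩ := koszul S.toList [] E
    (Cl.base E ⟨inferInstance, by simp⟩)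
  obtain ⟨n, hn⟩ := fgn_of_cl (fun B _ _ hB => by
    obtain ⟨hB1, hB2⟩ := hB
    apply finite_of_killed B
    intro x hx b
    rw [← hS] at hx
    have : Ideal.span (S : Set A) ≤ LinearMap.ker (LinearMap.toSpanSingleton A B b) := by
      rw [Ideal.span_le]
      intro y hy
      simpa using hB2 y (hl y (by simpa using hy)) b
    simpa using this hx) C hC
  obtain ⟨N, _, _, hN, hNT⟩ := vv_of_fgn n C hn
  exact ⟨N, _, _, hN, fun T _ _ hT => (hNT T).1 (h1 T hT), fun T _ _ hk hT =>
    h2 T (fun x hx => hk x (hSm x (by simpa using hx))) ((hNT T).2 hT)⟩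

end

section
variable {A : Type u} [CommRing A]

theorem injDim_of_ev (n : ℕ) : ∀ (Z : Type u) [AddCommGroup Z] [Module A Z],
    (∀ I : Ideal A, ∀ i, n < i → EV A (A ⧸ I) Z i) → InjDimLE A n Z := by
  induction n with
  | zero =>
    intro Z _ _ h
    change Module.Injective A Z
    rw [← Module.Baer.iff_injective]
    intro I g
    obtain ⟨g', hg⟩ := ev_c_lift (f := Submodule.subtype I) (g := Submodule.mkQ I)
      (Submodule.injective_subtype I) (by
        rw [LinearMap.exact_iff]; simp) (Submodule.mkQ_surjective I) (h I 1 (by norm_num)) g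
    exact ⟨g', fun x hx => LinearMap.congr_fun hg ⟨x, hx⟩⟩
  | succ n ih =>
    intro Z _ _ h
    let J := Injective.under (ModuleCat.of A Z)
    let i := Injective.ι (ModuleCat.of A Z)
    have hJ : Module.Injective A J :=
      Module.injective_module_of_injective_object A J (inj := (inferInstance : Injective
      (Injective.under (ModuleCat.of A Z))))
    have hi : Function.Injective i.hom := (ModuleCat.mono_iff_injective i).1 inferInstance
    refine ⟨J, inferInstance, inferInstance, hJ, i.hom, hi, ih _ ?_⟩
    intro I k hk
    obtain ⟨p, rfl⟩ : ∃ p, k = p + 1 := ⟨k - 1, by omega⟩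
    refine ev_v3 (f := i.hom) (g := (LinearMap.range i.hom).mkQ) hi ?_
      (Submodule.mkQ_surjective _) (ev_of_inj p) (h I (p+2) (by omega))
    rw [LinearMap.exact_iff]; simp

theorem mul_exact {I K : Ideal A} (a : A) (hK : ∀ y, y ∈ K ↔ a * y ∈ I)
    (hle : K ≤ Submodule.comap (LinearMap.lsmul A A a) I) :
    Function.Injective (Submodule.mapQ K I (LinearMap.lsmul A A a) hle) ∧
    Function.Exact (Submodule.mapQ K I (LinearMap.lsmul A A a) hle)
      (Submodule.factor (le_sup_left : I ≤ I ⊔ Ideal.span {a})) ∧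
    Function.Surjective (Submodule.factor (le_sup_left : I ≤ I ⊔ Ideal.span {a})) := by
  refine ⟨?_, ?_, Submodule.factor_surjective _⟩
  · rw [injective_iff_map_eq_zero]
    intro y hy
    obtain ⟨y, rfl⟩ := Submodule.Quotient.mk_surjective _ y
    rw [Submodule.mapQ_apply, Submodule.Quotient.mk_eq_zero] at hy
    rw [Submodule.Quotient.mk_eq_zero]
    exact (hK y).2 hy
  · intro y
    obtain ⟨y, rfl⟩ := Submodule.Quotient.mk_surjective _ y
    constructor
    · intro hy
      have hy' : y ∈ I ⊔ Ideal.span {a} := (Submodule.Quotient.mk_eq_zero _).1 hy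
      obtain ⟨c, hc, d, hd, rfl⟩ := Submodule.mem_sup.1 hy'
      obtain ⟨e, rfl⟩ := Ideal.mem_span_singleton'.1 hd
      refine ⟨Submodule.Quotient.mk e, ?_⟩
      rw [Submodule.mapQ_apply]
      refine (Submodule.Quotient.eq _).2 ?_
      simp only [LinearMap.lsmul_apply, smul_eq_mul]
      have : a * e - (c + e * a) = - c := by ring
      rw [this]; exact neg_mem hc
    · rintro ⟨z, hz⟩
      obtain ⟨z, rfl⟩ := Submodule.Quotient.mk_surjective _ z
      rw [← hz, Submodule.mapQ_apply]
      refine (Submodule.Quotient.mk_eq_zero _).2 ?_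
      exact Ideal.mem_sup_right (Ideal.mul_mem_right _ _ (Ideal.mem_span_singleton_self a))

theorem ev_quot_all [IsLocalRing A] [IsNoetherianRing A] {n : ℕ}
    (h : ∀ i, n < i → EV A (ResidueField A) A i) (I : Ideal A) :
    ∀ i, n < i → EV A (A ⧸ I) A i := by
  induction I using WellFoundedGT.induction with
  | ind I ih =>
  intro i hi
  by_cases htop : I = ⊤
  · have : Subsingleton (A ⧸ I) := Ideal.Quotient.subsingleton_iff.2 htop
    exact ev_of_subsingleton
  by_cases hm : I = maximalIdeal A
  · subst hm
    exact h i hi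
  have hlt : ∀ a, a ∉ I → I < I ⊔ Ideal.span {a} := by
    intro a ha
    refine lt_of_le_of_ne le_sup_left ?_
    intro h'
    exact ha (h' ▸ Ideal.mem_sup_right (Ideal.mem_span_singleton_self a))
  by_cases hp : I.IsPrime
  · obtain ⟨x, hx, hxI⟩ : ∃ x ∈ maximalIdeal A, x ∉ I := by
      by_contra! hcon
      exact hm (le_antisymm (le_maximalIdeal htop) hcon)
    have hK : ∀ y, y ∈ I ↔ x * y ∈ I := fun y => ⟨fun hy => Ideal.mul_mem_left _ _ hy,
      fun hy => (hp.mem_or_mem hy).resolve_left hxI⟩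
    obtain ⟨h1, h2, h3⟩ := mul_exact x hK (fun y hy => (hK y).1 hy)
    have hsurj : ∀ e : Abelian.Ext (ModuleCat.of A (A ⧸ I)) (ModuleCat.of A A) i,
        ∃ e', x • e' = e := by
      intro e
      obtain ⟨e', he'⟩ := Abelian.Ext.contravariant_sequence_exact₁ (ses_mod h1 h2 h3)
        (ModuleCat.of A A) e (add_comm 1 i) (ih _ (hlt x hxI) (i+1) (by omega) _)
      refine ⟨e', ?_⟩
      rw [← he']
      have hf : (ModuleCat.shortComplexOfCompEqZero _ _ h2.linearMap_comp_eq_zero).f =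
          x • 𝟙 (ModuleCat.of A (A ⧸ I)) := by
        ext
        rfl
      have : x • e' = (Abelian.Ext.mk₀ (x • 𝟙 (ModuleCat.of A (A ⧸ I)))).comp e' (zero_add i) := by
        simp [Abelian.Ext.mk₀_smul, Abelian.Ext.smul_comp]
      rw [this, ← hf]
    have hfin : Module.Finite A (Abelian.Ext (ModuleCat.of A (A ⧸ I)) (ModuleCat.of A A) i) :=
      ModuleCat.finite_ext A _ _ i
    have : (⊤ : Submodule A (Abelian.Ext (ModuleCat.of A (A ⧸ I)) (ModuleCat.of A A) i)) = ⊥ := by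
      apply Submodule.eq_bot_of_le_smul_of_le_jacobson_bot (maximalIdeal A) _ hfin.fg_top
      · intro e _
        obtain ⟨e', rfl⟩ := hsurj e
        exact Submodule.smul_mem_smul hx trivial
      · exact (jacobson_eq_maximalIdeal ⊥ bot_ne_top).ge
    intro e
    have he : e ∈ (⊤ : Submodule A
      (Abelian.Ext (ModuleCat.of A (A ⧸ I)) (ModuleCat.of A A) i)) := trivial
    rw [this] at he
    exact he
  · obtain ⟨a, b, hab, ha, hb⟩ : ∃ a b, a * b ∈ I ∧ a ∉ I ∧ b ∉ I := by
      by_contra! hcon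
      refine hp ⟨htop, fun {a b} hab => ?_⟩
      by_contra! h'
      exact h'.2 (hcon a b hab h'.1)
    let K : Ideal A := Submodule.comap (LinearMap.lsmul A A a) I
    have hK : ∀ y, y ∈ K ↔ a * y ∈ I := fun y => Iff.rfl
    obtain ⟨h1, h2, h3⟩ := mul_exact a hK le_rfl
    refine ev_c2 h1 h2 h3 (ih K ?_ i hi) (ih _ (hlt a ha) i hi)
    refine lt_of_le_of_ne (fun y hy => Ideal.mul_mem_left _ _ hy) ?_
    intro h'
    exact hb (h' ▸ hab)

theorem gorenstein_of_ev [IsLocalRing A] [IsNoetherianRing A] {n : ℕ}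
    (h : ∀ i, n < i → EV A (ResidueField A) A i) : IsGorensteinLocalRing A :=
  ⟨inferInstance, inferInstance, n, injDim_of_ev n A (ev_quot_all h)⟩

end
/-- Theorem `Gorenstein` of the paper. Let `(A, m, k)` be a noetherian
local ring and `M` a test module for `A`. If `G-dim_A(M) < ∞` then `A` is a Gorenstein
ring (no dualizing complex hypothesis needed). -/
theorem gorenstein_of_test_module_of_finite_G_dim
    (A : Type u) [CommRing A] [IsLocalRing A] [IsNoetherianRing A]
    (M : Type u) [AddCommGroup M] [Module A M] [Module.Finite A M]
    (htest : IsTestModule A M) (hG : ∃ n : ℕ, GDimLE A n M) :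
    IsGorensteinLocalRing A := by
  obtain ⟨n, hn⟩ := hG
  obtain ⟨E, _, _, hE, hArt, -, s, hs0, hs⟩ := exists_E (A := A)
  have h1 : VV A E (CharacterModule M) := by
    refine ⟨n, fun i hi => ?_⟩
    obtain ⟨p, rfl⟩ : ∃ p, i = p + 1 := ⟨i - 1, by omega⟩
    exact (ev_duality E hs0 hs p M).1 (ev_of_gdim n M hn (p+1) hi)
  obtain ⟨N, _, _, hN, hEN, hNE⟩ := exists_fg_model (A := A) E
  obtain ⟨m, hm⟩ := hEN _ h1
  obtain ⟨d, hd⟩ := htest A (by rw [Algebra.algebraMap_self]; infer_instance) N hN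
    ⟨m+1, fun i hi => by
      obtain ⟨p, rfl⟩ : ∃ p, i = p + 1 := ⟨i - 1, by omega⟩
      exact torVanish_of_ev p (hm (p+1) (by omega))⟩
  obtain ⟨r, hr⟩ := hNE (CharacterModule (ResidueField A))
    (fun x hx t => by
      ext y
      change t (x • y) = 0
      have : x • y = 0 := by
        rw [Algebra.smul_def, ResidueField.algebraMap_eq, (residue_eq_zero_iff x).2 hx, zero_mul]
      rw [this, map_zero])
    ⟨d, fun i hi => ev_of_flatDim d N hd _ i hi⟩
  apply gorenstein_of_ev (n := r)
  intro i hi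
  obtain ⟨p, rfl⟩ : ∃ p, i = p + 1 := ⟨i - 1, by omega⟩
  exact (ev_duality E hs0 hs p (ResidueField A)).2 (hr (p+1) hi)
end
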